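/- Let G be a finite group and σ a partition of the set of all primes. Then G is a σ-soluble PσT-group if and only if for every prime p dividing |G|, every Sylow p-subgroup P of G, and every maximal subgroup V of P, there exists a subgroup T of G with VT = G such that T is a σ-soluble PσT-group. -/

import Mathlib

open scoped Pointwise

/-- `σ` is a partition of the set of all primes: each class is nonempty, the
classes are pairwise disjoint, and their union is the set of all primes. -/
def SigmaPartition {ι : Type*} (σ : ι → Set ℕ) : Prop :=
  (∀ i, (σ i).Nonempty) ∧ (Pairwise fun i j => Disjoint (σ i) (σ j)) ∧
    (⋃ i, σ i) = {p : ℕ | p.Prime}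

/-- A group is `σ`-primary if all primes dividing its order lie in a single class `σ i`. -/
def SigmaPrimary {ι : Type*} (σ : ι → Set ℕ) (G : Type*) [Group G] : Prop :=
  ∃ i, ∀ p : ℕ, p.Prime → p ∣ Nat.card G → p ∈ σ i

/-- A group is `σ`-soluble if it has a normal series all of whose factors are
`σ`-primary (the order of the factor `c k.succ / c k.castSucc` is the index
`((c k.castSucc).subgroupOf (c k.succ)).index`). -/
def SigmaSoluble {ι : Type*} (σ : ι → Set ℕ) (G : Type*) [Group G] : Prop :=
  ∃ (n : ℕ) (c : Fin (n + 1) → Subgroup G),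
    c 0 = ⊥ ∧ c (Fin.last n) = ⊤ ∧ Monotone c ∧ (∀ k, (c k).Normal) ∧
    ∀ k : Fin n, ∃ i, ∀ p : ℕ, p.Prime →
      p ∣ ((c k.castSucc).subgroupOf (c k.succ)).index → p ∈ σ i

/-- A group is `σ`-nilpotent if it is the (internal) direct product of finitely many
`σ`-primary (normal) subgroups. -/
def SigmaNilpotent {ι : Type*} (σ : ι → Set ℕ) (G : Type*) [Group G] : Prop :=
  ∃ (n : ℕ) (H : Fin n → Subgroup G),
    (∀ k, (H k).Normal) ∧ iSupIndep H ∧ (⨆ k, H k) = ⊤ ∧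
    ∀ k, ∃ i, ∀ p : ℕ, p.Prime → p ∣ Nat.card (H k) → p ∈ σ i

/-- A Hall `ρ`-subgroup: all primes dividing its order lie in `ρ`, and no prime
dividing its index lies in `ρ`. -/
def IsHallSubgroup {G : Type*} [Group G] (ρ : Set ℕ) (H : Subgroup G) : Prop :=
  (∀ p : ℕ, p.Prime → p ∣ Nat.card H → p ∈ ρ) ∧
  (∀ p : ℕ, p.Prime → p ∣ H.index → p ∉ ρ)

/-- A Hall `σ i`-subgroup of `G`. -/
def IsHallSigmaSubgroup {ι : Type*} (σ : ι → Set ℕ) {G : Type*} [Group G]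
    (i : ι) (H : Subgroup G) : Prop :=
  IsHallSubgroup (σ i) H

/-- A complete Hall `σ`-set of `G`: every nontrivial member is a Hall
`σ i`-subgroup for some `i`, and for every `i` with `σ i ∩ π(G) ≠ ∅` the set
contains exactly one Hall `σ i`-subgroup of `G`. -/
def CompleteHallSigmaSet {ι : Type*} (σ : ι → Set ℕ) (G : Type*) [Group G]
    (ℋ : Set (Subgroup G)) : Prop :=
  (∀ H ∈ ℋ, H ≠ ⊥ → ∃ i, IsHallSigmaSubgroup σ i H) ∧
  ∀ i, (∃ p : ℕ, p.Prime ∧ p ∈ σ i ∧ p ∣ Nat.card G) →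
    ∃! H : Subgroup G, H ∈ ℋ ∧ IsHallSigmaSubgroup σ i H

/-- A subgroup `A` is `σ`-permutable in `G` if `G` has a complete Hall `σ`-set `ℋ`
with `A Hˣ = Hˣ A` for all `H ∈ ℋ` and all `x ∈ G`. -/
def SigmaPermutable {ι : Type*} (σ : ι → Set ℕ) {G : Type*} [Group G]
    (A : Subgroup G) : Prop :=
  ∃ ℋ : Set (Subgroup G), CompleteHallSigmaSet σ G ℋ ∧
    ∀ H ∈ ℋ, ∀ x : G,
      (A : Set G) * (H.map (MulAut.conj x).toMonoidHom : Set G) =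
        (H.map (MulAut.conj x).toMonoidHom : Set G) * (A : Set G)

/-- `G` is a `PσT`-group: `σ`-permutability is transitive, i.e. if `H` is
`σ`-permutable in `G` and `K` is `σ`-permutable in `H`, then `K` is
`σ`-permutable in `G`. -/
def IsPSigmaT {ι : Type*} (σ : ι → Set ℕ) (G : Type*) [Group G] : Prop :=
  ∀ H : Subgroup G, SigmaPermutable σ H →
    ∀ K : Subgroup ↥H, SigmaPermutable σ K →
      SigmaPermutable σ (K.map H.subtype)


namespace PST

set_option linter.all false
set_option linter.unusedVariables false
set_option linter.unusedSectionVars false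

/-- `n` is a `π`-number. -/
def PN (π : Set ℕ) (n : ℕ) : Prop := ∀ p : ℕ, p.Prime → p ∣ n → p ∈ π

theorem PN.dvd {π : Set ℕ} {m n : ℕ} (h : PN π n) (hd : m ∣ n) : PN π m :=
  fun p hp hpm => h p hp (hpm.trans hd)

theorem PN.mul {π : Set ℕ} {m n : ℕ} (h : PN π m) (h' : PN π n) : PN π (m * n) :=
  fun p hp hpm => ((hp.dvd_mul).1 hpm).elim (h p hp) (h' p hp)

theorem PN.one {π : Set ℕ} : PN π 1 :=
  fun p hp hpm => absurd (Nat.dvd_one.1 hpm) hp.one_lt.ne'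

theorem PN.mono {π ρ : Set ℕ} {n : ℕ} (h : PN π n) (hs : π ⊆ ρ) : PN ρ n :=
  fun p hp hpm => hs (h p hp hpm)

theorem PN.eq_one {π : Set ℕ} {n : ℕ} (h : PN π n) (h' : PN πᶜ n) : n = 1 := by
  by_contra hn
  obtain ⟨p, hp, hpn⟩ := Nat.exists_prime_and_dvd hn
  exact h' p hp hpn (h p hp hpn)

theorem PN.coprime {π : Set ℕ} {m n : ℕ} (h : PN π m) (h' : PN πᶜ n) : Nat.Coprime m n :=
  PN.eq_one (π := π) (h.dvd (Nat.gcd_dvd_left _ _)) (h'.dvd (Nat.gcd_dvd_right _ _))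

theorem PN.inter {π ρ : Set ℕ} {n : ℕ} (h : PN π n) (h' : PN ρ n) : PN (π ∩ ρ) n :=
  fun p hp hpm => ⟨h p hp hpm, h' p hp hpm⟩

theorem PN.compl_compl {π : Set ℕ} {n : ℕ} : PN πᶜᶜ n ↔ PN π n := by rw [_root_.compl_compl]

theorem exists_parts (π : Set ℕ) (n : ℕ) (hn : n ≠ 0) :
    ∃ a b, n = a * b ∧ PN π a ∧ PN πᶜ b := by
  induction n using Nat.recOnMul with
  | zero => exact absurd rfl hn
  | one => exact ⟨1, 1, rfl, PN.one, PN.one⟩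
  | prime p hp =>
    by_cases h : p ∈ π
    · refine ⟨p, 1, by simp, fun q hq hd => ?_, PN.one⟩
      rwa [(Nat.prime_dvd_prime_iff_eq hq hp).1 hd]
    · refine ⟨1, p, by simp, PN.one, fun q hq hd => ?_⟩
      rwa [(Nat.prime_dvd_prime_iff_eq hq hp).1 hd]
  | mul m k hm hk =>
    obtain ⟨a, b, rfl, ha, hb⟩ := hm (by rintro rfl; simp at hn)
    obtain ⟨c, d, rfl, hc, hd⟩ := hk (by rintro rfl; simp at hn)
    exact ⟨a * c, b * d, by ring, ha.mul hc, hb.mul hd⟩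

section basics
variable {G Q : Type*} [Group G] [Finite G] [Group Q]

theorem lift_elem (π : Set ℕ) (f : G →* Q) (y : G) (h : PN π (orderOf (f y))) :
    ∃ t : ℕ, f (y ^ t) = f y ∧ PN π (orderOf (y ^ t)) := by
  obtain ⟨a, b, hab, ha, hb⟩ := exists_parts π (orderOf y) (orderOf_pos y).ne'
  have hco : Nat.Coprime a b := ha.coprime hb
  have hd : orderOf (f y) ∣ a :=
    (h.coprime hb).dvd_of_dvd_mul_right (hab ▸ orderOf_map_dvd f y)
  obtain ⟨t, ht1, ht2⟩ := Nat.chineseRemainder hco 1 0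
  refine ⟨t, ?_, ha.dvd ?_⟩
  · rw [map_pow]
    conv_rhs => rw [← pow_one (f y)]
    exact pow_eq_pow_iff_modEq.2 (ht1.of_dvd hd)
  · apply orderOf_dvd_of_pow_eq_one
    rw [← pow_mul]
    apply orderOf_dvd_iff_pow_eq_one.1
    rw [hab, mul_comm]
    exact Nat.mul_dvd_mul ((Nat.modEq_zero_iff_dvd).1 ht2) dvd_rfl

theorem elem_of_card {π : Set ℕ} {H : Subgroup G} (hH : PN π (Nat.card H)) {h : G} (hh : h ∈ H) :
    PN π (orderOf h) :=
  hH.dvd (Subgroup.orderOf_dvd_natCard H hh)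

theorem card_of_elem {π : Set ℕ} {H : Subgroup G} (hH : ∀ h ∈ H, PN π (orderOf h)) :
    PN π (Nat.card H) := by
  intro p hp hd
  have := Fact.mk hp
  obtain ⟨x, hx⟩ := exists_prime_orderOf_dvd_card' p hd
  refine hH x.1 x.2 p hp ?_
  rw [Subgroup.orderOf_coe, hx]

theorem mem_of_index {π : Set ℕ} {N : Subgroup G} [N.Normal] (hN : PN πᶜ N.index) {g : G}
    (hg : PN π (orderOf g)) : g ∈ N := by
  rw [← QuotientGroup.eq_one_iff, ← orderOf_eq_one_iff]
  refine PN.eq_one (π := π) (hg.dvd (orderOf_map_dvd (QuotientGroup.mk' N) g)) (hN.dvd ?_)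
  rw [Subgroup.index_eq_card]
  exact orderOf_dvd_natCard _

theorem relIndex_eq_of_cover {H K L : Subgroup G} (hKL : K ≤ L)
    (hc : ∀ l ∈ L, ∃ k ∈ K, ∃ h ∈ H, l = k * h) : H.relIndex L = H.relIndex K := by
  symm
  apply Nat.card_congr
  refine Equiv.ofBijective (Subgroup.quotientSubgroupOfEmbeddingOfLE H hKL)
    ⟨(Subgroup.quotientSubgroupOfEmbeddingOfLE H hKL).injective, ?_⟩
  intro y
  induction y using QuotientGroup.induction_on with
  | H l =>
    obtain ⟨k, hk, h, hh, e⟩ := hc l.1 l.2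
    refine ⟨QuotientGroup.mk ⟨k, hk⟩, ?_⟩
    rw [Subgroup.quotientSubgroupOfEmbeddingOfLE_apply_mk]
    rw [QuotientGroup.eq, Subgroup.mem_subgroupOf]
    simpa [e] using hh

theorem cover_of_relIndex_eq {H K L : Subgroup G} (hKL : K ≤ L)
    (he : H.relIndex L = H.relIndex K) : ∀ l ∈ L, ∃ k ∈ K, ∃ h ∈ H, l = k * h := by
  intro l hl
  have hb : Function.Bijective (Subgroup.quotientSubgroupOfEmbeddingOfLE H hKL) := by
    rw [Nat.bijective_iff_injective_and_card]
    exact ⟨(Subgroup.quotientSubgroupOfEmbeddingOfLE H hKL).injective, he.symm⟩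
  obtain ⟨y, hy⟩ := hb.2 (QuotientGroup.mk ⟨l, hl⟩)
  induction y using QuotientGroup.induction_on with
  | H k =>
    rw [Subgroup.quotientSubgroupOfEmbeddingOfLE_apply_mk, QuotientGroup.eq,
      Subgroup.mem_subgroupOf] at hy
    refine ⟨k, k.2, _, hy, ?_⟩
    simp

theorem cover_of_coprime {H K L : Subgroup G} (hHL : H ≤ L) (hKL : K ≤ L)
    (hc : Nat.Coprime (H.relIndex L) (K.relIndex L)) :
    ∀ l ∈ L, ∃ k ∈ K, ∃ h ∈ H, l = k * h := by
  apply cover_of_relIndex_eq hKL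
  have h1 : H.relIndex L ∣ H.relIndex K * K.relIndex L := by
    have := Subgroup.relIndex_inf_mul_relIndex (H := H) (K := K) (L := L)
    rw [inf_eq_left.2 hKL] at this
    rw [this]
    exact Subgroup.relIndex_dvd_of_le_left L inf_le_left
  have h2 : H.relIndex L ≤ H.relIndex K := Nat.le_of_dvd (Nat.pos_of_ne_zero Subgroup.FiniteIndex.index_ne_zero) (hc.dvd_of_dvd_mul_right h1)
  have h3 : H.relIndex K ≤ H.relIndex L := Subgroup.relIndex_le_of_le_right hKL (H := H) Subgroup.FiniteIndex.index_ne_zero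
  omega

theorem relIndex_sup_normal (X N : Subgroup G) [N.Normal] : X.relIndex (X ⊔ N) = X.relIndex N := by
  apply relIndex_eq_of_cover le_sup_right
  intro l hl
  rw [sup_comm, ← SetLike.mem_coe, Subgroup.normal_mul] at hl
  obtain ⟨a, ha, b, hb, rfl⟩ := hl
  exact ⟨a, ha, b, hb, rfl⟩

/-- a normal `π`-subgroup lies in every subgroup of index prime to π. -/
theorem normal_le_hall {π : Set ℕ} {N X : Subgroup G} [N.Normal] (hN : PN π (Nat.card N))
    (hX : PN πᶜ X.index) : N ≤ X := by
  rw [← Subgroup.relIndex_eq_one]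
  refine PN.eq_one (hN.dvd (Subgroup.relIndex_dvd_card _ _)) (hX.dvd ?_)
  rw [← relIndex_sup_normal]
  exact Subgroup.relIndex_dvd_index_of_le le_sup_left

theorem card_relIndex {H K : Subgroup G} (h : H ≤ K) :
    H.relIndex K * Nat.card H = Nat.card K := by
  rw [← Subgroup.relIndex_bot_left H, ← Subgroup.relIndex_bot_left K, mul_comm]
  exact Subgroup.relIndex_mul_relIndex _ _ _ bot_le h

/-- If a normal subgroup, together with the right numbers. -/
theorem card_sup_normal {π : Set ℕ} {H N : Subgroup G} [N.Normal] (hH : PN π (Nat.card H))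
    (hN : PN π (Nat.card N)) : PN π (Nat.card ↥(H ⊔ N)) := by
  rw [← card_relIndex (le_sup_left : H ≤ H ⊔ N), relIndex_sup_normal]
  exact (hN.dvd (Subgroup.relIndex_dvd_card _ _)).mul hH

/-- the largest normal `π`-subgroup. -/
theorem exists_core (π : Set ℕ) (G : Type*) [Group G] [Finite G] :
    ∃ F : Subgroup G, F.Normal ∧ PN π (Nat.card F) ∧
      ∀ N : Subgroup G, N.Normal → PN π (Nat.card N) → N ≤ F := by
  obtain ⟨F, hF⟩ := (Set.toFinite {N : Subgroup G | N.Normal ∧ PN π (Nat.card N)}).exists_maximal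
    ⟨⊥, inferInstance, by simpa using PN.one⟩
  refine ⟨F, hF.prop.1, hF.prop.2, fun N hN hc => ?_⟩
  have := hF.prop.1
  exact le_sup_left.trans (hF.le_of_ge (y := N ⊔ F)
    ⟨inferInstance, card_sup_normal hc hF.prop.2⟩ le_sup_right)

/-- existence of minimal normal subgroups. -/
theorem exists_min_normal (N : Subgroup G) [N.Normal] (hN : N ≠ ⊥) :
    ∃ R : Subgroup G, R.Normal ∧ R ≠ ⊥ ∧ R ≤ N ∧
      ∀ M : Subgroup G, M.Normal → M ≤ R → M = ⊥ ∨ M = R := by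
  obtain ⟨R, hR⟩ :=
    (Set.toFinite {M : Subgroup G | M.Normal ∧ M ≠ ⊥ ∧ M ≤ N}).exists_minimal
    ⟨N, inferInstance, hN, le_rfl⟩
  refine ⟨R, hR.prop.1, hR.prop.2.1, hR.prop.2.2, fun M hM hMR => ?_⟩
  by_cases h : M = ⊥
  · exact Or.inl h
  · exact Or.inr (le_antisymm hMR (hR.le_of_le (y := M) ⟨hM, h, hMR.trans hR.prop.2.2⟩ hMR))

/-- the set of `π`-elements being closed gives a normal subgroup. -/
theorem normal_in_of_hall {π : Set ℕ} {B H : Subgroup G} [B.Normal] (hHB : H ≤ B)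
    (hmem : ∀ b ∈ B, PN π (orderOf b) → b ∈ H) (hH : PN π (Nat.card H)) : H.Normal := by
  constructor
  intro h hh g
  refine hmem _ (‹B.Normal›.conj_mem _ (hHB hh) g) ?_
  have : orderOf (g * h * g⁻¹) = orderOf h := by
    have := orderOf_injective (MulAut.conj g).toMonoidHom (MulAut.conj g).injective h
    simpa using this
  rw [this]
  exact elem_of_card hH hh

/-- central Schur-Zassenhaus -/
theorem central_hall {π : Set ℕ} {A B : Subgroup G} [hA : A.Normal] [hB : B.Normal] (hAB : A ≤ B)
    (hc : ∀ a ∈ A, ∀ b ∈ B, a * b = b * a) (h1 : PN πᶜ (Nat.card A)) (h2 : PN π (A.relIndex B)) :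
    ∃ H : Subgroup G, H.Normal ∧ H ≤ B ∧ PN π (Nat.card H) ∧ PN πᶜ (H.relIndex B) := by
  have hcard : Nat.card (A.subgroupOf B) = Nat.card A :=
    Nat.card_congr (Subgroup.subgroupOfEquivOfLe hAB).toEquiv
  obtain ⟨K, hK⟩ := Subgroup.exists_right_complement'_of_coprime (N := A.subgroupOf B)
    (by rw [hcard]; exact (h2.coprime h1).symm)
  have hKn : K.Normal := by
    constructor
    intro k hk g
    have hg : g ∈ (A.subgroupOf B) ⊔ K := by rw [hK.sup_eq_top]; trivial
    rw [← SetLike.mem_coe, Subgroup.normal_mul] at hg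
    obtain ⟨a, ha, l, hl, rfl⟩ := hg
    have hcm : ∀ b : B, a * b = b * a := fun b =>
      Subtype.ext (hc a.1 (Subgroup.mem_subgroupOf.1 ha) b.1 b.2)
    have : a * l * k * (a * l)⁻¹ = l * k * l⁻¹ := by
      rw [mul_assoc a l k, hcm (l * k), mul_inv_rev]
      have h3 : l⁻¹ * a⁻¹ = a⁻¹ * l⁻¹ := by rw [← mul_inv_rev, hcm l, mul_inv_rev]
      rw [h3]; group
    show a * l * k * (a * l)⁻¹ ∈ K
    rw [this]
    exact K.mul_mem (K.mul_mem hl hk) (K.inv_mem hl)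
  have hKc : Nat.card K = A.relIndex B := by rw [Subgroup.relIndex, hK.symm.index_eq_card]
  have hKi : K.index = Nat.card A := by rw [hK.index_eq_card, hcard]
  have hmc : Nat.card (K.map B.subtype) = Nat.card K :=
    Subgroup.card_map_of_injective B.subtype_injective
  have hle : K.map B.subtype ≤ B := Subgroup.map_subtype_le K
  refine ⟨K.map B.subtype, ?_, hle, by rw [hmc, hKc]; exact h2, ?_⟩
  · refine normal_in_of_hall (π := π) hle ?_ (by rw [hmc, hKc]; exact h2)
    intro b hb hbo
    refine ⟨⟨b, hb⟩, ?_, rfl⟩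
    refine mem_of_index (π := π) (by rw [hKi]; exact h1) ?_
    rwa [Subgroup.orderOf_mk]
  · rw [Subgroup.relIndex, Subgroup.subgroupOf, Subgroup.comap_map_eq_self_of_injective B.subtype_injective, hKi]
    exact h1

end basics
end PST

namespace PST

set_option linter.all false
set_option linter.unusedVariables false
set_option linter.unusedSectionVars false

universe u

section LPsec
variable {G Q : Type*} [Group G] [Finite G] [Group Q] [Finite Q]

theorem relIndex_dvd_right (A : Subgroup G) [A.Normal] {K L : Subgroup G} (h : K ≤ L) :
    A.relIndex K ∣ A.relIndex L := by
  have h1 := Subgroup.relIndex_ker (QuotientGroup.mk' A) (K := K)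
  have h2 := Subgroup.relIndex_ker (QuotientGroup.mk' A) (K := L)
  rw [QuotientGroup.ker_mk'] at h1 h2
  rw [h1, h2]
  exact Subgroup.card_dvd_of_le (Subgroup.map_mono h)

theorem card_comap_surj (f : G →* Q) (hf : Function.Surjective f) (A : Subgroup Q) :
    Nat.card (A.comap f) = Nat.card A * Nat.card f.ker := by
  rw [← card_relIndex (Subgroup.ker_le_comap f A), Subgroup.relIndex_ker,
    Subgroup.map_comap_eq_self_of_surjective hf]

/-- the local property. -/
def LP (π : Set ℕ) (G : Type*) [Group G] : Prop :=
  ∃ A B : Subgroup G, A.Normal ∧ B.Normal ∧ A ≤ B ∧ PN πᶜ (Nat.card A) ∧ PN π (A.relIndex B) ∧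
    PN πᶜ B.index ∧ ∀ h g : G, PN π (orderOf h) → PN πᶜ (orderOf g) →
      ∃ n : ℤ, g * h * g⁻¹ * (h ^ n)⁻¹ ∈ A

theorem LP.of_injective {π : Set ℕ} (h : LP π G) (f : Q →* G) (hf : Function.Injective f) :
    LP π Q := by
  obtain ⟨A, B, hA, hB, hAB, h1, h2, h3, h4⟩ := h
  refine ⟨A.comap f, B.comap f, inferInstance, inferInstance, Subgroup.comap_mono hAB,
    h1.dvd (Subgroup.card_comap_dvd_of_injective _ _ hf), ?_, ?_, ?_⟩
  · rw [Subgroup.relIndex_comap]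
    exact h2.dvd (relIndex_dvd_right A (Subgroup.map_comap_le f B))
  · refine h3.dvd ?_
    rw [Subgroup.index_comap]
    exact Subgroup.relIndex_dvd_index_of_normal _ _
  · intro h g hh hg
    obtain ⟨n, hn⟩ := h4 (f h) (f g) (by rwa [orderOf_injective f hf])
      (by rwa [orderOf_injective f hf])
    exact ⟨n, by simpa [Subgroup.mem_comap] using hn⟩

theorem LP.map {π : Set ℕ} (h : LP π G) (f : G →* Q) (hf : Function.Surjective f) :
    LP π Q := by
  obtain ⟨A, B, hA, hB, hAB, h1, h2, h3, h4⟩ := h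
  refine ⟨A.map f, B.map f, hA.map f hf, hB.map f hf, Subgroup.map_mono hAB,
    h1.dvd (Subgroup.card_map_dvd A f), ?_, h3.dvd (Subgroup.index_map_dvd _ hf), ?_⟩
  · rw [← Subgroup.relIndex_comap]
    exact h2.dvd (Subgroup.relIndex_dvd_of_le_left _ (Subgroup.le_comap_map f A))
  · intro h g hh hg
    obtain ⟨h, rfl⟩ := hf h
    obtain ⟨g, rfl⟩ := hf g
    obtain ⟨s, hs1, hs2⟩ := lift_elem π f h hh
    obtain ⟨t, ht1, ht2⟩ := lift_elem πᶜ f g hg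
    obtain ⟨n, hn⟩ := h4 _ _ hs2 ht2
    refine ⟨n, ?_⟩
    rw [← hs1, ← ht1, ← map_zpow, ← map_inv, ← map_inv, ← map_mul, ← map_mul, ← map_mul]
    exact Subgroup.mem_map_of_mem f hn

theorem LP.lift {π : Set ℕ} (h : LP π Q) (f : G →* Q) (hf : Function.Surjective f)
    (hk : PN πᶜ (Nat.card f.ker)) : LP π G := by
  obtain ⟨A, B, hA, hB, hAB, h1, h2, h3, h4⟩ := h
  refine ⟨A.comap f, B.comap f, inferInstance, inferInstance, Subgroup.comap_mono hAB,
    ?_, ?_, ?_, ?_⟩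
  · rw [card_comap_surj f hf]; exact h1.mul hk
  · rw [Subgroup.relIndex_comap, Subgroup.map_comap_eq_self_of_surjective hf]; exact h2
  · rw [Subgroup.index_comap_of_surjective _ hf]; exact h3
  · intro h g hh hg
    obtain ⟨n, hn⟩ := h4 (f h) (f g) (hh.dvd (orderOf_map_dvd f h)) (hg.dvd (orderOf_map_dvd f g))
    exact ⟨n, by simpa [Subgroup.mem_comap] using hn⟩

end LPsec

section SS
variable {ι : Type*} {σ : ι → Set ℕ} {G Q : Type*} [Group G] [Finite G] [Group Q] [Finite Q]

theorem sig_compl (hσ : SigmaPartition σ) {i j : ι} (hij : i ≠ j) {n : ℕ} (h : PN (σ j) n) :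
    PN (σ i)ᶜ n :=
  h.mono (fun _ hx hi => (Set.disjoint_left.1 (hσ.2.1 hij)) hi hx)

theorem sig_exists (hσ : SigmaPartition σ) {p : ℕ} (hp : p.Prime) : ∃ i, p ∈ σ i := by
  have : p ∈ ⋃ i, σ i := by rw [hσ.2.2]; exact hp
  simpa using this

theorem SS_of_injective (h : SigmaSoluble σ G) (f : Q →* G) (hf : Function.Injective f) :
    SigmaSoluble σ Q := by
  obtain ⟨n, c, h0, hl, hm, hn, hc⟩ := h
  refine ⟨n, fun k => (c k).comap f, ?_, ?_, fun a b hab => Subgroup.comap_mono (hm hab),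
    fun k => (hn k).comap f, fun k => ?_⟩
  · simp only [h0]; rw [MonoidHom.comap_bot]; exact (MonoidHom.ker_eq_bot_iff f).2 hf
  · simp [hl]
  · obtain ⟨i, hi⟩ := hc k
    refine ⟨i, PN.dvd (π := σ i) hi ?_⟩
    have := hn k.castSucc
    show ((c k.castSucc).comap f).relIndex ((c k.succ).comap f) ∣
      (c k.castSucc).relIndex (c k.succ)
    rw [Subgroup.relIndex_comap]
    exact relIndex_dvd_right _ (Subgroup.map_comap_le f _)

theorem SS_map (h : SigmaSoluble σ G) (f : G →* Q) (hf : Function.Surjective f) :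
    SigmaSoluble σ Q := by
  obtain ⟨n, c, h0, hl, hm, hn, hc⟩ := h
  refine ⟨n, fun k => (c k).map f, ?_, ?_, fun a b hab => Subgroup.map_mono (hm hab),
    fun k => (hn k).map f hf, fun k => ?_⟩
  · simp only [h0]; simp
  · simp only [hl]; exact Subgroup.map_top_of_surjective f hf
  · obtain ⟨i, hi⟩ := hc k
    refine ⟨i, PN.dvd (π := σ i) hi ?_⟩
    show ((c k.castSucc).map f).relIndex ((c k.succ).map f) ∣
      (c k.castSucc).relIndex (c k.succ)
    rw [← Subgroup.relIndex_comap]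
    exact Subgroup.relIndex_dvd_of_le_left _ (Subgroup.le_comap_map f _)

theorem SS_lift (h : SigmaSoluble σ Q) (f : G →* Q) (hf : Function.Surjective f) {i : ι}
    (hk : PN (σ i) (Nat.card f.ker)) : SigmaSoluble σ G := by
  obtain ⟨n, c, h0, hl, hm, hn, hc⟩ := h
  refine ⟨n + 1, Fin.cons ⊥ (fun k => (c k).comap f), rfl, ?_, ?_, ?_, ?_⟩
  · rw [← Fin.succ_last, Fin.cons_succ, hl]; simp
  · intro a b hab
    induction a using Fin.cases with
    | zero => simp
    | succ a =>
      induction b using Fin.cases with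
      | zero => exact absurd hab (by simp)
      | succ b =>
        rw [Fin.cons_succ, Fin.cons_succ]
        exact Subgroup.comap_mono (hm (Fin.succ_le_succ_iff.1 hab))
  · intro k
    induction k using Fin.cases with
    | zero => rw [Fin.cons_zero]; infer_instance
    | succ k => rw [Fin.cons_succ]; exact (hn k).comap f
  · intro k
    induction k using Fin.cases with
    | zero =>
      refine ⟨i, ?_⟩
      rw [Fin.castSucc_zero, Fin.cons_zero, Fin.cons_succ, h0, MonoidHom.comap_bot]
      show PN (σ i) ((⊥ : Subgroup G).relIndex f.ker)
      rwa [Subgroup.relIndex_bot_left]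
    | succ k =>
      obtain ⟨j, hj⟩ := hc k
      refine ⟨j, ?_⟩
      rw [Fin.cons_succ, ← Fin.succ_castSucc, Fin.cons_succ]
      show PN (σ j) (((c k.castSucc).comap f).relIndex ((c k.succ).comap f))
      rw [Subgroup.relIndex_comap, Subgroup.map_comap_eq_self_of_surjective hf]
      exact hj

theorem SS_min (h : SigmaSoluble σ G) (N : Subgroup G) [hN : N.Normal] (hne : N ≠ ⊥) :
    ∃ i, ∃ M : Subgroup G, M.Normal ∧ M ≠ ⊥ ∧ M ≤ N ∧ PN (σ i) (Nat.card M) := by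
  obtain ⟨n, c, h0, hl, hm, hn, hc⟩ := h
  by_contra hcon
  push Not at hcon
  have key : ∀ k, c k ⊓ N = ⊥ := by
    intro k
    induction k using Fin.induction with
    | zero => simp [h0]
    | succ k ih =>
      by_contra hne'
      obtain ⟨i, hi⟩ := hc k
      have h1 := hn k.castSucc
      have h2 := hn k.succ
      refine hcon i (c k.succ ⊓ N) inferInstance hne' inf_le_right (PN.dvd (π := σ i) hi ?_)
      show _ ∣ (c k.castSucc).relIndex (c k.succ)
      have e : (c k.castSucc).relIndex (c k.succ ⊓ N) = Nat.card ↥(c k.succ ⊓ N) := by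
        rw [← Subgroup.inf_relIndex_right]
        have : c k.castSucc ⊓ (c k.succ ⊓ N) = ⊥ := by
          rw [eq_bot_iff, ← ih]; exact inf_le_inf le_rfl inf_le_right
        rw [this, Subgroup.relIndex_bot_left]
      rw [← e]
      exact relIndex_dvd_right _ inf_le_left
  exact hne (by simpa [hl] using key (Fin.last n))

theorem SS_minimal (h : SigmaSoluble σ G) (N : Subgroup G) [hN : N.Normal] (hne : N ≠ ⊥) :
    ∃ i, ∃ R : Subgroup G, R.Normal ∧ R ≠ ⊥ ∧ R ≤ N ∧ PN (σ i) (Nat.card R) ∧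
      ∀ M : Subgroup G, M.Normal → M ≤ R → M = ⊥ ∨ M = R := by
  obtain ⟨i, M, h1, h2, h3, h4⟩ := SS_min h N hne
  obtain ⟨R, a, b, c, d⟩ := exists_min_normal M h2
  exact ⟨i, R, a, b, c.trans h3, h4.dvd (Subgroup.card_dvd_of_le c), d⟩

theorem card_quot_lt (N : Subgroup G) (hN : N ≠ ⊥) : Nat.card (G ⧸ N) < Nat.card G := by
  rw [Subgroup.card_eq_card_quotient_mul_card_subgroup N]
  have h1 : 0 < Nat.card (G ⧸ N) := Nat.card_pos
  have h2 : 1 < Nat.card N := (Subgroup.one_lt_card_iff_ne_bot N).2 hN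
  nlinarith

theorem card_sub_lt (N : Subgroup G) (hN : N ≠ ⊤) : Nat.card N < Nat.card G := by
  refine lt_of_le_of_ne (Subgroup.card_le_card_group N) fun h => hN ?_
  exact Subgroup.eq_top_of_card_eq _ h

theorem ker_mk'_card (N : Subgroup G) [N.Normal] :
    Nat.card (QuotientGroup.mk' N).ker = Nat.card N := by rw [QuotientGroup.ker_mk']

/-- lift of Hall subgroups -/
theorem hall_lift (hσ : SigmaPartition σ) {i k : ι} (f : G →* Q) (hf : Function.Surjective f)
    (hk : PN (σ k) (Nat.card f.ker)) (X : Subgroup Q) (hX : IsHallSubgroup (σ i) X) :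
    ∃ Y : Subgroup G, IsHallSubgroup (σ i) Y ∧ Y.map f = X := by
  by_cases hki : k = i
  · subst hki
    refine ⟨X.comap f, ⟨?_, ?_⟩, Subgroup.map_comap_eq_self_of_surjective hf _⟩
    · rw [card_comap_surj f hf]; exact PN.mul hX.1 hk
    · rw [Subgroup.index_comap_of_surjective _ hf]; exact hX.2
  · have hk' : PN (σ i)ᶜ (Nat.card f.ker) := sig_compl hσ (Ne.symm hki) hk
    have hle : f.ker ≤ X.comap f := Subgroup.ker_le_comap f X
    have hcard : Nat.card (f.ker.subgroupOf (X.comap f)) = Nat.card f.ker :=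
      Nat.card_congr (Subgroup.subgroupOfEquivOfLe hle).toEquiv
    have hidx : (f.ker.subgroupOf (X.comap f)).index = Nat.card X := by
      show f.ker.relIndex _ = _
      rw [Subgroup.relIndex_ker, Subgroup.map_comap_eq_self_of_surjective hf]
    obtain ⟨K, hK⟩ := Subgroup.exists_right_complement'_of_coprime
      (N := f.ker.subgroupOf (X.comap f))
      (by rw [hcard, hidx]; exact (PN.coprime hX.1 hk').symm)
    have hKc : Nat.card K = Nat.card X := by rw [← hidx, hK.symm.index_eq_card]
    have hKi : K.index = Nat.card f.ker := by rw [hK.index_eq_card, hcard]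
    have hmc : Nat.card (K.map (X.comap f).subtype) = Nat.card K :=
      Subgroup.card_map_of_injective (Subgroup.subtype_injective _)
    refine ⟨K.map (X.comap f).subtype, ⟨?_, ?_⟩, ?_⟩
    · rw [hmc, hKc]; exact hX.1
    · rw [Subgroup.index_map_subtype, hKi, Subgroup.index_comap_of_surjective _ hf]
      exact hk'.mul hX.2
    · apply le_antisymm
      · rw [Subgroup.map_le_iff_le_comap]
        exact Subgroup.map_subtype_le K
      · intro x hx
        obtain ⟨y, rfl⟩ := hf x
        have hg : (⟨y, hx⟩ : X.comap f) ∈ (f.ker.subgroupOf (X.comap f)) ⊔ K := by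
          rw [hK.sup_eq_top]; trivial
        rw [← SetLike.mem_coe, Subgroup.normal_mul] at hg
        obtain ⟨a, ha, l, hl, e⟩ := hg
        refine ⟨l.1, ⟨l, hl, rfl⟩, ?_⟩
        have e' : a.1 * l.1 = y := congrArg Subtype.val e
        rw [← e', map_mul, (MonoidHom.mem_ker).1 (Subgroup.mem_subgroupOf.1 ha), one_mul]

end SS

theorem SS_of_subsingleton {ι : Type*} (σ : ι → Set ℕ) (G : Type*) [Group G] [Subsingleton G] :
    SigmaSoluble σ G :=
  ⟨0, fun _ => ⊥, rfl, Subsingleton.elim _ _, fun _ _ _ => le_rfl, fun _ => inferInstance,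
    fun k => k.elim0⟩

theorem hall_exists_aux {ι : Type*} {σ : ι → Set ℕ} (hσ : SigmaPartition σ) (i : ι) (n : ℕ) :
    ∀ (G : Type u) [Group G] [Finite G], Nat.card G = n → SigmaSoluble σ G →
      ∃ H : Subgroup G, IsHallSubgroup (σ i) H := by
  induction n using Nat.strong_induction_on with
  | _ n ih =>
    intro G _ _ hn hG
    by_cases htop : (⊤ : Subgroup G) = ⊥
    · refine ⟨⊤, ?_, ?_⟩
      · rw [htop, Subgroup.card_bot]; exact PN.one
      · rw [Subgroup.index_top]; exact PN.one (π := (σ i)ᶜ)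
    · obtain ⟨k, R, hR, hR1, -, hRc⟩ := SS_min hG ⊤ htop
      obtain ⟨X, hX⟩ := ih _ (hn ▸ card_quot_lt R hR1) (G ⧸ R) rfl
        (SS_map hG (QuotientGroup.mk' R) (QuotientGroup.mk'_surjective R))
      obtain ⟨Y, hY, -⟩ := hall_lift hσ (QuotientGroup.mk' R) (QuotientGroup.mk'_surjective R)
        (k := k) (by rw [ker_mk'_card]; exact hRc) X hX
      exact ⟨Y, hY⟩

theorem hall_exists {ι : Type*} {σ : ι → Set ℕ} (hσ : SigmaPartition σ) (i : ι)
    {G : Type u} [Group G] [Finite G] (hG : SigmaSoluble σ G) :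
    ∃ H : Subgroup G, IsHallSubgroup (σ i) H := hall_exists_aux hσ i _ G rfl hG

section HHsec
variable {ι : Type*} {σ : ι → Set ℕ} {G : Type*} [Group G] [Finite G]

theorem HH (hσ : SigmaPartition σ) (hG : SigmaSoluble σ G) (i : ι)
    (hO : ∀ N : Subgroup G, N.Normal → PN (σ i)ᶜ (Nat.card N) → N = ⊥)
    (F : Subgroup G) [hF : F.Normal] (hFc : PN (σ i) (Nat.card F))
    (hmax : ∀ N : Subgroup G, N.Normal → PN (σ i) (Nat.card N) → N ≤ F)
    (g : G) (hg : ∀ f ∈ F, g * f = f * g) : g ∈ F := by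
  set f := QuotientGroup.mk' F with hfdef
  have hf : Function.Surjective f := QuotientGroup.mk'_surjective F
  set C := Subgroup.centralizer (F : Set G) with hC
  have hCn : C.Normal := inferInstance
  have hCbn : (C.map f).Normal := hCn.map f hf
  have hgC : g ∈ C := by
    rw [hC, Subgroup.mem_centralizer_iff]; intro h hh; exact (hg h hh).symm
  by_cases hb : C.map f = ⊥
  · have : f g ∈ C.map f := Subgroup.mem_map_of_mem f hgC
    rw [hb, Subgroup.mem_bot] at this
    exact (QuotientGroup.eq_one_iff g).1 this
  exfalso
  obtain ⟨k, X, hX, hX1, hXC, hXc⟩ := SS_min (SS_map hG f hf) (C.map f) hb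
  set B := X.comap f ⊓ C with hB
  have hBn : B.Normal := inferInstance
  have hker : f.ker = F := QuotientGroup.ker_mk' F
  suffices hBF : B ≤ F by
    apply hX1
    rw [eq_bot_iff]
    intro x hx
    obtain ⟨c, hc, rfl⟩ := hXC hx
    have : c ∈ F := hBF ⟨hx, hc⟩
    rw [Subgroup.mem_bot]
    exact (QuotientGroup.eq_one_iff c).2 this
  apply hmax B hBn
  by_cases hki : k = i
  · subst hki
    refine PN.dvd ?_ (Subgroup.card_dvd_of_le (inf_le_left : B ≤ X.comap f))
    rw [card_comap_surj f hf, hker]; exact hXc.mul hFc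
  · have hAn : (B ⊓ F).Normal := inferInstance
    obtain ⟨H, hH1, hH2, hH3, hH4⟩ := central_hall (π := (σ i)ᶜ) (A := B ⊓ F) (B := B) inf_le_left
      (fun a ha b hb => (Subgroup.mem_centralizer_iff.1 hb.2 a ha.2))
      (by
        rw [PN.compl_compl]
        exact hFc.dvd (Subgroup.card_dvd_of_le inf_le_right))
      (by
        refine sig_compl hσ (Ne.symm hki) (hXc.dvd ?_)
        rw [inf_comm, Subgroup.inf_relIndex_right]
        refine (relIndex_dvd_right F (inf_le_left : B ≤ X.comap f)).trans ?_
        have e := Subgroup.relIndex_ker f (K := X.comap f)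
        rw [hker, Subgroup.map_comap_eq_self_of_surjective hf] at e
        rw [e])
    rw [hO H hH1 hH3, PN.compl_compl, Subgroup.relIndex_bot_left] at hH4
    exact hH4

end HHsec
end PST

namespace PST

set_option linter.all false
set_option linter.unusedVariables false
set_option linter.unusedSectionVars false

universe u

section s3
variable {G Q : Type*} [Group G] [Finite G] [Group Q] [Finite Q]

theorem eq_one_of_PN {π : Set ℕ} {x : G} (h1 : PN π (orderOf x)) (h2 : PN πᶜ (orderOf x)) :
    x = 1 := orderOf_eq_one_iff.1 (PN.eq_one h1 h2)

theorem eq_one_of_mem {π : Set ℕ} {H K : Subgroup G} (h1 : PN π (Nat.card H))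
    (h2 : PN πᶜ (Nat.card K)) {x : G} (hx : x ∈ H) (hx' : x ∈ K) : x = 1 :=
  eq_one_of_PN (elem_of_card h1 hx) (elem_of_card h2 hx')

theorem mem_norm_of_conj {S : Subgroup G} {x : G} (h : ∀ n ∈ S, x * n * x⁻¹ ∈ S) :
    x ∈ Subgroup.normalizer (S : Set G) :=
  Subgroup.mem_normalizer_fintype h

theorem conj_of_mem_norm {S : Subgroup G} {x : G} (hx : x ∈ Subgroup.normalizer (S : Set G))
    {n : G} (hn : n ∈ S) : x * n * x⁻¹ ∈ S :=
  (Subgroup.mem_normalizer_iff.1 hx n).1 hn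

theorem norm_zpowers {g r : G} :
    (∃ n : ℤ, g * r * g⁻¹ = r ^ n) ↔ g ∈ Subgroup.normalizer (Subgroup.zpowers r : Set G) := by
  constructor
  · rintro ⟨n, hn⟩
    apply mem_norm_of_conj
    intro x hx
    obtain ⟨k, rfl⟩ := Subgroup.mem_zpowers_iff.1 hx
    rw [← conj_zpow, hn]
    exact Subgroup.zpow_mem _ (Subgroup.zpow_mem _ (Subgroup.mem_zpowers r) _) _
  · intro h
    have := conj_of_mem_norm h (Subgroup.mem_zpowers r)
    obtain ⟨k, hk⟩ := Subgroup.mem_zpowers_iff.1 this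
    exact ⟨k, hk.symm⟩

theorem dichotomy {π : Set ℕ} (R : Subgroup G) [hR : R.Normal] (hRc : PN π (Nat.card R))
    (hmin : ∀ M : Subgroup G, M.Normal → M ≤ R → M = ⊥ ∨ M = R)
    (hn : ∀ r ∈ R, ∀ g, PN πᶜ (orderOf g) → ∃ n : ℤ, g * r * g⁻¹ = r ^ n) :
    (∀ a ∈ R, ∀ b ∈ R, a * b = b * a) ∨ (∀ g, PN πᶜ (orderOf g) → ∀ r ∈ R, g * r = r * g) := by
  set S : Set G := {g | PN πᶜ (orderOf g)}
  set E := Subgroup.normalClosure S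
  let M : Subgroup G := ⨅ r : R, Subgroup.normalizer (Subgroup.zpowers (r : G) : Set G)
  have hM : ∀ g, g ∈ M ↔ ∀ r ∈ R, ∃ n : ℤ, g * r * g⁻¹ = r ^ n := by
    intro g
    simp only [M, Subgroup.mem_iInf, ← norm_zpowers, Subtype.forall]
  have hMn : M.Normal := by
    constructor
    intro g hg x
    rw [hM] at hg ⊢
    intro r hr
    obtain ⟨n, hn⟩ := hg (x⁻¹ * r * x) (by simpa using hR.conj_mem r hr x⁻¹)
    refine ⟨n, ?_⟩
    have e : x⁻¹ * r * x = x⁻¹ * r * x⁻¹⁻¹ := by simp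
    rw [e, conj_zpow] at hn
    calc x * g * x⁻¹ * r * (x * g * x⁻¹)⁻¹
        = x * (g * (x⁻¹ * r * x⁻¹⁻¹) * g⁻¹) * x⁻¹ := by group
      _ = r ^ n := by rw [hn]; group
  have hEM : E ≤ M := Subgroup.normalClosure_le_normal (fun g hg => (hM g).2 (fun r hr => hn r hr g hg))
  rcases hmin (R ⊓ E) inferInstance inf_le_left with h | h
  · right
    intro g hg r hr
    exact (Subgroup.commute_of_normal_of_disjoint E R inferInstance hR
      (by rw [disjoint_iff, inf_comm]; exact h) g r (Subgroup.subset_normalClosure hg) hr).eq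
  · left
    have hRM : R ≤ M := (inf_eq_left.1 h).trans hEM
    have hnil : Group.IsNilpotent R := by
      refine ((Group.isNilpotent_of_finite_tfae (G := R)).out 0 2).2 ?_
      intro H _
      constructor
      intro x hx g
      obtain ⟨n, hn⟩ := (hM g).1 (hRM g.2) x x.2
      have : g * x * g⁻¹ = x ^ n := Subtype.ext (by simpa using hn)
      rw [this]
      exact H.zpow_mem hx n
    by_cases hRb : R = ⊥
    · rw [hRb]; intro a ha b hb
      rw [Subgroup.mem_bot.1 ha, Subgroup.mem_bot.1 hb]
    have hnt : Nontrivial R := (Subgroup.nontrivial_iff_ne_bot R).2 hRb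
    have hc : Subgroup.center R ≠ ⊥ := Group.IsNilpotent.center_ne_bot _
    have hcm : ((Subgroup.center R).map R.subtype).Normal := inferInstance
    rcases hmin _ hcm (Subgroup.map_subtype_le _) with h' | h'
    · exact absurd ((Subgroup.map_eq_bot_iff_of_injective _ R.subtype_injective).1 h') hc
    · intro a ha b hb
      rw [← h'] at ha
      obtain ⟨c, hc, rfl⟩ := ha
      have := (Subgroup.mem_center_iff.1 hc) ⟨b, hb⟩
      exact (congrArg Subtype.val this).symm

theorem abel_conj {π : Set ℕ} (N W X : Subgroup G) [hN : N.Normal]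
    (hNc : ∀ a ∈ N, ∀ b ∈ N, a * b = b * a)
    (h1 : PN πᶜ (Nat.card N)) (h2 : PN π (Nat.card W)) (h3 : PN π (Nat.card X))
    (hc : ∀ w ∈ W, ∃ x ∈ X, ∃ r ∈ N, w = x * r) : ∃ g : G, ∀ w ∈ W, g⁻¹ * w * g ∈ X := by
  classical
  letI : CommGroup N :=
    { (inferInstance : Group N) with mul_comm := fun a b => Subtype.ext (hNc a a.2 b b.2) }
  have := Fintype.ofFinite W
  choose x hx r hr e using fun w : W => hc w.1 w.2
  have cj : ∀ (w : W) (n : N), w.1⁻¹ * n.1 * w.1 ∈ N := fun w n => by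
    simpa using hN.conj_mem n n.2 w.1⁻¹
  let φ : W → N →* N := fun w =>
    { toFun := fun n => ⟨w.1⁻¹ * n.1 * w.1, cj w n⟩
      map_one' := Subtype.ext (by simp)
      map_mul' := fun a b => Subtype.ext (by simp; group) }
  let ρ : W → N := fun w => ⟨r w, hr w⟩
  have hcoc : ∀ w w' : W, ρ (w * w') = φ w' (ρ w) * ρ w' := by
    intro w w'
    apply Subtype.ext
    show r (w * w') = w'.1⁻¹ * r w * w'.1 * r w'
    have e1 : (w.1 * w'.1) = x (w * w') * r (w * w') := e (w * w')
    have hm : (w'.1⁻¹ * r w * w'.1) ∈ N := cj w' ⟨r w, hr w⟩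
    have e2 : w.1 * w'.1 = (x w * x w') * (w'.1⁻¹ * r w * w'.1 * r w') := by
      rw [hNc _ hm _ (hr w')]
      calc w.1 * w'.1 = x w * r w * w'.1 := by rw [← e w]
        _ = x w * w'.1 * (w'.1⁻¹ * r w * w'.1) := by group
        _ = x w * (x w' * r w') * (w'.1⁻¹ * r w * w'.1) := by rw [← e w']
        _ = _ := by group
    rw [e1] at e2
    have h4 : (x w * x w')⁻¹ * x (w * w') = (w'.1⁻¹ * r w * w'.1 * r w') * (r (w * w'))⁻¹ := by
      rw [eq_mul_inv_iff_mul_eq, mul_assoc, e2]; group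
    have h5 : (w'.1⁻¹ * r w * w'.1 * r w') * (r (w * w'))⁻¹ = 1 := by
      refine eq_one_of_mem h3 h1 ?_ (N.mul_mem (N.mul_mem hm (hr w')) (N.inv_mem (hr _)))
      rw [← h4]
      exact X.mul_mem (X.inv_mem (X.mul_mem (hx _) (hx _))) (hx _)
    exact (mul_inv_eq_one.1 h5).symm
  have hcop : (Nat.card N).Coprime (Nat.card W) := (h2.coprime h1).symm
  obtain ⟨b, hb⟩ := (powCoprime hcop).surjective (∏ w : W, ρ w)
  have hb' : b ^ (Nat.card W) = ∏ w : W, ρ w := hb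
  refine ⟨b.1⁻¹, fun w hw => ?_⟩
  set w' : W := ⟨w, hw⟩
  have h6 : ∏ w : W, ρ w = φ w' (∏ w : W, ρ w) * (ρ w') ^ (Nat.card W) := by
    calc ∏ w : W, ρ w = ∏ w : W, ρ (w * w') :=
          (Fintype.prod_equiv (Equiv.mulRight w') _ _ (fun _ => rfl)).symm
      _ = ∏ w : W, (φ w' (ρ w) * ρ w') := by simp_rw [hcoc]
      _ = _ := by
        rw [Finset.prod_mul_distrib, map_prod, Finset.prod_const, Finset.card_univ,
          Nat.card_eq_fintype_card]
  rw [← hb', map_pow, ← mul_pow] at h6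
  have h7 : b = φ w' b * ρ w' := (powCoprime hcop).injective h6
  have h8 : b.1 = w⁻¹ * b.1 * w * r w' := congrArg Subtype.val h7
  have h9 : w = x w' * r w' := e w'
  have hm : w * b.1⁻¹ * w⁻¹ ∈ N := hN.conj_mem _ (N.inv_mem b.2) w
  have h10 : b.1⁻¹⁻¹ * w * b.1⁻¹ = x w' := by
    have h11 : r w' = w⁻¹ * b.1⁻¹ * w * b.1 := by
      have : r w' = (w⁻¹ * b.1 * w)⁻¹ * b.1 := by rw [eq_inv_mul_iff_mul_eq]; exact h8.symm
      rw [this]; group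
    have h12 : x w' = w * (r w')⁻¹ := by rw [eq_mul_inv_iff_mul_eq]; exact h9.symm
    rw [h12, h11]
    calc b.1⁻¹⁻¹ * w * b.1⁻¹ = b.1 * (w * b.1⁻¹ * w⁻¹) * w := by group
      _ = (w * b.1⁻¹ * w⁻¹) * b.1 * w := by rw [hNc _ b.2 _ hm]
      _ = _ := by group
  rw [h10]
  exact hx _

theorem LP.norm_cyc {π : Set ℕ} (h : LP π G) (R : Subgroup G) [hR : R.Normal]
    (hRc : PN π (Nat.card R)) :
    ∀ r ∈ R, ∀ g, PN πᶜ (orderOf g) → ∃ n : ℤ, g * r * g⁻¹ = r ^ n := by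
  obtain ⟨A, B, hA, hB, hAB, h1, h2, h3, h4⟩ := h
  intro r hr g hg
  obtain ⟨n, hn⟩ := h4 r g (elem_of_card hRc hr) hg
  refine ⟨n, ?_⟩
  have := eq_one_of_mem hRc h1
    (R.mul_mem (hR.conj_mem r hr g) (R.inv_mem (R.zpow_mem hr n))) hn
  exact mul_inv_eq_one.1 this

theorem hall_map {π : Set ℕ} {X : Subgroup G} (hX : IsHallSubgroup π X) (f : G →* Q)
    (hf : Function.Surjective f) : IsHallSubgroup π (X.map f) :=
  ⟨PN.dvd hX.1 (Subgroup.card_map_dvd X f), PN.dvd (π := πᶜ) hX.2 (Subgroup.index_map_dvd _ hf)⟩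

theorem hall_conj {π : Set ℕ} {X : Subgroup G} (hX : IsHallSubgroup π X) (g : G) :
    IsHallSubgroup π (X.map (MulAut.conj g).toMonoidHom) :=
  hall_map hX _ (MulAut.conj g).surjective

theorem mem_conj_map {X : Subgroup G} {g x : G} :
    x ∈ X.map (MulAut.conj g).toMonoidHom ↔ g⁻¹ * x * g ∈ X := by
  constructor
  · rintro ⟨y, hy, rfl⟩
    have : g⁻¹ * ((MulAut.conj g).toMonoidHom y) * g = y := by simp; group
    rw [this]; exact hy
  · intro h
    exact ⟨_, h, by simp; group⟩

theorem hall_eq_of_le {π : Set ℕ} {X Y : Subgroup G} (hX : IsHallSubgroup π X)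
    (hY : IsHallSubgroup π Y) (h : Y ≤ X) : Y = X := by
  apply le_antisymm h
  rw [← Subgroup.relIndex_eq_one]
  exact PN.eq_one (PN.dvd hX.1 (Subgroup.relIndex_dvd_card _ _))
    (PN.dvd (π := πᶜ) hY.2 (Subgroup.relIndex_dvd_index_of_le h))

end s3

theorem dominance_aux {ι : Type*} {σ : ι → Set ℕ} (hσ : SigmaPartition σ) (i : ι) (n : ℕ) :
    ∀ (G : Type u) [Group G] [Finite G], Nat.card G = n → SigmaSoluble σ G →
      (∀ k, LP (σ k) G) → ∀ W X : Subgroup G, PN (σ i) (Nat.card W) → IsHallSubgroup (σ i) X →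
      ∃ g : G, ∀ w ∈ W, g⁻¹ * w * g ∈ X := by
  induction n using Nat.strong_induction_on with
  | _ n ih =>
    intro G _ _ hn hG hL W X hW hX
    by_cases htop : (⊤ : Subgroup G) = ⊥
    · refine ⟨1, fun w hw => ?_⟩
      have : w ∈ (⊤ : Subgroup G) := trivial
      rw [htop, Subgroup.mem_bot] at this
      subst this
      simpa using X.one_mem
    · obtain ⟨k, R, hR, hR1, -, hRc, hmin⟩ := SS_minimal hG ⊤ htop
      have hf := QuotientGroup.mk'_surjective R
      obtain ⟨g', hg⟩ := ih _ (hn ▸ card_quot_lt R hR1) (G ⧸ R) rfl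
        (SS_map hG _ hf) (fun k => (hL k).map _ hf) (W.map (QuotientGroup.mk' R))
        (X.map (QuotientGroup.mk' R)) (hW.dvd (Subgroup.card_map_dvd W _)) (hall_map hX _ hf)
      obtain ⟨g, rfl⟩ := hf g'
      have hg' : ∀ w ∈ W, ∃ x ∈ X, ∃ r ∈ R, g⁻¹ * w * g = x * r := by
        intro w hw
        obtain ⟨x, hx, e⟩ := hg _ (Subgroup.mem_map_of_mem _ hw)
        rw [← map_inv, ← map_mul, ← map_mul] at e
        refine ⟨x, hx, x⁻¹ * (g⁻¹ * w * g), ?_, by group⟩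
        exact (QuotientGroup.eq).1 e
      by_cases hki : k = i
      · subst hki
        refine ⟨g, fun w hw => ?_⟩
        obtain ⟨x, hx, r, hr, e⟩ := hg' w hw
        rw [e]
        exact X.mul_mem hx (normal_le_hall hRc hX.2 hr)
      · have hRc' : PN (σ i)ᶜ (Nat.card R) := sig_compl hσ (Ne.symm hki) hRc
        have hord : ∀ w ∈ W, PN (σ i) (orderOf (g⁻¹ * w * g)) := by
          intro w hw
          have := orderOf_injective (MulAut.conj g⁻¹).toMonoidHom (MulAut.conj g⁻¹).injective w
          simp only [MulEquiv.coe_toMonoidHom, MulAut.conj_apply, inv_inv] at this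
          rw [this]
          exact elem_of_card hW hw
        rcases dichotomy R hRc hmin ((hL k).norm_cyc R hRc) with hab | hcen
        · obtain ⟨b, hb⟩ := abel_conj (π := σ i) R (W.map (MulAut.conj g⁻¹).toMonoidHom) X hab hRc'
            (hW.dvd (Subgroup.card_map_dvd W _)) hX.1 (by
              rintro _ ⟨w, hw, rfl⟩
              simpa using hg' w hw)
          refine ⟨g * b, fun w hw => ?_⟩
          have := hb _ (Subgroup.mem_map_of_mem _ hw)
          simp only [MulEquiv.coe_toMonoidHom, MulAut.conj_apply, inv_inv] at this
          have e : (g * b)⁻¹ * w * (g * b) = b⁻¹ * (g⁻¹ * w * g) * b := by group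
          rw [e]; exact this
        · refine ⟨g, fun w hw => ?_⟩
          obtain ⟨x, hx, r, hr, e⟩ := hg' w hw
          have hw' := hord w hw
          have hcm := hcen _ (sig_compl hσ hki hw') r hr
          have hr1 : r = 1 := by
            apply eq_one_of_PN (π := σ i) _ (elem_of_card hRc' hr)
            have hx' : x = (g⁻¹ * w * g) * r⁻¹ := by rw [e]; group
            have e2 : r = x⁻¹ * (g⁻¹ * w * g) := by rw [e]; group
            have hcx : Commute x⁻¹ (g⁻¹ * w * g) := by
              apply Commute.inv_left
              rw [hx']
              exact (Commute.refl _).mul_left (Commute.inv_left (Commute.symm hcm))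
            have hd := hcx.orderOf_mul_dvd_mul_orderOf
            rw [← e2, orderOf_inv] at hd
            exact PN.dvd (PN.mul (elem_of_card hX.1 hx) hw') hd
          rw [e, hr1, mul_one]
          exact hx

section s4
variable {ι : Type*} {σ : ι → Set ℕ} {G : Type u} [Group G] [Finite G]

theorem dominance (hσ : SigmaPartition σ) {i : ι} (hG : SigmaSoluble σ G)
    (hL : ∀ k, LP (σ k) G) {W X : Subgroup G} (hW : PN (σ i) (Nat.card W))
    (hX : IsHallSubgroup (σ i) X) :
    ∃ g : G, W ≤ X.map (MulAut.conj g).toMonoidHom := by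
  obtain ⟨g, hg⟩ := dominance_aux hσ i _ G rfl hG hL W X hW hX
  exact ⟨g, fun w hw => mem_conj_map.2 (hg w hw)⟩

theorem hall_conjugate (hσ : SigmaPartition σ) {i : ι} (hG : SigmaSoluble σ G)
    (hL : ∀ k, LP (σ k) G) {X Y : Subgroup G} (hX : IsHallSubgroup (σ i) X)
    (hY : IsHallSubgroup (σ i) Y) :
    ∃ g : G, Y = X.map (MulAut.conj g).toMonoidHom := by
  obtain ⟨g, hg⟩ := dominance hσ hG hL hY.1 hX
  exact ⟨g, hall_eq_of_le (hall_conj hX g) hY hg⟩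

end s4
end PST

namespace PST

set_option linter.all false
set_option linter.unusedVariables false
set_option linter.unusedSectionVars false

universe u

section s1
variable {ι : Type*} {σ : ι → Set ℕ} {G Q : Type*} [Group G] [Finite G] [Group Q] [Finite Q]

/-- elementwise permutability -/
def Perm (A B : Subgroup G) : Prop := ∀ a ∈ A, ∀ b ∈ B, ∃ b' ∈ B, ∃ a' ∈ A, a * b = b' * a'

theorem Perm.symm {A B : Subgroup G} (h : Perm A B) : Perm B A := by
  intro b hb a ha
  obtain ⟨b', hb', a', ha', e⟩ := h a⁻¹ (A.inv_mem ha) b⁻¹ (B.inv_mem hb)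
  refine ⟨a'⁻¹, A.inv_mem ha', b'⁻¹, B.inv_mem hb', ?_⟩
  rw [← mul_inv_rev, ← e]; group

theorem perm_iff {A B : Subgroup G} :
    (A : Set G) * (B : Set G) = (B : Set G) * (A : Set G) ↔ Perm A B := by
  constructor
  · intro h a ha b hb
    have : a * b ∈ (A : Set G) * (B : Set G) := Set.mul_mem_mul ha hb
    rw [h] at this
    obtain ⟨b', hb', a', ha', e⟩ := this
    exact ⟨b', hb', a', ha', e.symm⟩
  · intro h
    apply Set.Subset.antisymm
    · rintro _ ⟨a, ha, b, hb, rfl⟩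
      obtain ⟨b', hb', a', ha', e⟩ := h a ha b hb
      exact ⟨b', hb', a', ha', e.symm⟩
    · rintro _ ⟨b, hb, a, ha, rfl⟩
      obtain ⟨a', ha', b', hb', e⟩ := h.symm b hb a ha
      exact ⟨a', ha', b', hb', e.symm⟩

theorem perm_of_normal (A B : Subgroup G) [hA : A.Normal] : Perm A B := by
  intro a ha b hb
  refine ⟨b, hb, b⁻¹ * a * b, by simpa using hA.conj_mem a ha b⁻¹, by group⟩

theorem complete_range (hσ : SigmaPartition σ) (Y : ι → Subgroup G)
    (hY : ∀ i, IsHallSubgroup (σ i) (Y i)) : CompleteHallSigmaSet σ G (Set.range Y) := by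
  refine ⟨?_, ?_⟩
  · rintro _ ⟨i, rfl⟩ _
    exact ⟨i, hY i⟩
  · rintro i ⟨p, hp, hpi, hpG⟩
    refine ⟨Y i, ⟨⟨i, rfl⟩, hY i⟩, ?_⟩
    rintro _ ⟨⟨j, rfl⟩, hj⟩
    by_cases hij : i = j
    · rw [hij]
    · exfalso
      have h1 : PN (σ i) (Nat.card (Y j)) := hj.1
      have h2 : PN (σ i)ᶜ (Nat.card (Y j)) := sig_compl hσ hij (hY j).1
      have h3 : Nat.card (Y j) = 1 := h1.eq_one h2
      rw [← Subgroup.card_mul_index (Y j), h3, one_mul] at hpG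
      exact hj.2 p hp hpG hpi

theorem sp_iff (hσ : SigmaPartition σ) (A : Subgroup G) : SigmaPermutable σ A ↔
    ∃ Y : ι → Subgroup G, (∀ i, IsHallSubgroup (σ i) (Y i)) ∧
      ∀ i x, Perm A ((Y i).map (MulAut.conj x).toMonoidHom) := by
  constructor
  · rintro ⟨ℋ, ⟨h1, h2⟩, h3⟩
    have : ∀ i, ∃ Y : Subgroup G, IsHallSubgroup (σ i) Y ∧
        ∀ x, Perm A (Y.map (MulAut.conj x).toMonoidHom) := by
      intro i
      by_cases hi : ∃ p : ℕ, p.Prime ∧ p ∈ σ i ∧ p ∣ Nat.card G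
      · obtain ⟨Y, ⟨hY1, hY2⟩, -⟩ := h2 i hi
        exact ⟨Y, hY2, fun x => perm_iff.1 (h3 Y hY1 x)⟩
      · refine ⟨⊥, ⟨?_, ?_⟩, ?_⟩
        · rw [Subgroup.card_bot]; exact PN.one
        · intro p hp hd hpi
          rw [Subgroup.index_bot] at hd
          exact hi ⟨p, hp, hpi, hd⟩
        · intro x
          rw [Subgroup.map_bot]
          exact (perm_of_normal ⊥ A).symm
    choose Y hY1 hY2 using this
    exact ⟨Y, hY1, hY2⟩
  · rintro ⟨Y, h1, h2⟩
    refine ⟨Set.range Y, complete_range hσ Y h1, ?_⟩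
    rintro _ ⟨i, rfl⟩ x
    exact perm_iff.2 (h2 i x)

theorem sp_lift (hσ : SigmaPartition σ) (f : G →* Q) (hf : Function.Surjective f) {k : ι}
    (hk : PN (σ k) (Nat.card f.ker)) (A : Subgroup Q) (hA : SigmaPermutable σ A) :
    SigmaPermutable σ (A.comap f) := by
  rw [sp_iff hσ] at hA ⊢
  obtain ⟨Y, h1, h2⟩ := hA
  choose Z hZ1 hZ2 using fun i => hall_lift hσ f hf hk (Y i) (h1 i)
  refine ⟨Z, hZ1, fun i x a ha b hb => ?_⟩
  rw [mem_conj_map] at hb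
  obtain ⟨b', hb', a', ha', e⟩ := h2 i (f x) (f a) ha (f b) (by
    rw [mem_conj_map, ← hZ2, ← map_inv, ← map_mul, ← map_mul]
    exact Subgroup.mem_map_of_mem f hb)
  rw [mem_conj_map, ← hZ2] at hb'
  obtain ⟨z, hz, ez⟩ := hb'
  have hb1 : f (x * z * x⁻¹) = b' := by
    rw [map_mul, map_mul, map_inv, ez]; group
  refine ⟨x * z * x⁻¹, ?_, (x * z * x⁻¹)⁻¹ * (a * b), ?_, by group⟩
  · rw [mem_conj_map]
    have : x⁻¹ * (x * z * x⁻¹) * x = z := by group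
    rw [this]; exact hz
  · rw [Subgroup.mem_comap, map_mul, map_inv, hb1, map_mul, e]
    simpa using ha'

theorem sp_map (hσ : SigmaPartition σ) (f : G →* Q) (hf : Function.Surjective f)
    (A : Subgroup G) (hA : SigmaPermutable σ A) : SigmaPermutable σ (A.map f) := by
  rw [sp_iff hσ] at hA ⊢
  obtain ⟨Y, h1, h2⟩ := hA
  refine ⟨fun i => (Y i).map f, fun i => hall_map (h1 i) f hf, fun i x a ha b hb => ?_⟩
  obtain ⟨x, rfl⟩ := hf x
  obtain ⟨a, ha, rfl⟩ := ha
  rw [mem_conj_map] at hb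
  obtain ⟨z, hz, ez⟩ := hb
  have hb1 : b = f (x * z * x⁻¹) := by
    rw [map_mul, map_mul, map_inv, ez]; group
  obtain ⟨b', hb', a', ha', e⟩ := h2 i x a ha (x * z * x⁻¹) (by
    rw [mem_conj_map]
    have : x⁻¹ * (x * z * x⁻¹) * x = z := by group
    rw [this]; exact hz)
  refine ⟨f b', ?_, f a', Subgroup.mem_map_of_mem f ha', by rw [hb1, ← map_mul, e, map_mul]⟩
  rw [mem_conj_map] at hb' ⊢
  rw [← map_inv, ← map_mul, ← map_mul]
  exact Subgroup.mem_map_of_mem f hb'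

theorem PsT_map (hσ : SigmaPartition σ) (f : G →* Q) (hf : Function.Surjective f) {k : ι}
    (hk : PN (σ k) (Nat.card f.ker)) (hG : IsPSigmaT σ G) : IsPSigmaT σ Q := by
  intro H hH K hK
  have h1 := sp_lift hσ f hf hk H hH
  have hs : Function.Surjective (f.subgroupComap H) :=
    MonoidHom.subgroupComap_surjective_of_surjective f H hf
  have h2 := sp_lift hσ (f.subgroupComap H) hs (k := k) (by
    apply card_of_elem
    intro h hh
    rw [← Subgroup.orderOf_coe]
    refine elem_of_card hk ?_
    have := congrArg Subtype.val (MonoidHom.mem_ker.1 hh)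
    exact this) K hK
  have h3 := sp_map hσ f hf _ (hG _ h1 _ h2)
  convert h3 using 1
  ext x
  constructor
  · rintro ⟨y, hy, rfl⟩
    obtain ⟨z, rfl⟩ := hs y
    exact ⟨z.1, ⟨z, hy, rfl⟩, rfl⟩
  · rintro ⟨_, ⟨z, hz, rfl⟩, rfl⟩
    exact ⟨f.subgroupComap H z, hz, rfl⟩

theorem norm_core {π : Set ℕ} (N : Subgroup G)
    (h : ∀ p, p.Prime → p ∉ π → p ∣ Nat.card G →
      ∃ Y : Subgroup G, ¬ p ∣ Y.index ∧ ∀ x, ∀ y ∈ Y, x * y * x⁻¹ ∈ N) :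
    ∀ g, PN πᶜ (orderOf g) → g ∈ N := by
  intro g hg
  apply N.normalCore_le
  refine mem_of_index (π := πᶜ) ?_ hg
  rw [PN.compl_compl]
  intro p hp hd
  by_contra hpi
  obtain ⟨Y, hY1, hY2⟩ := h p hp hpi (hd.trans (Subgroup.index_dvd_card _))
  apply hY1
  refine hd.trans (Subgroup.index_dvd_of_le ?_)
  intro y hy x
  exact hY2 x y hy

end s1

section s2
variable {ι : Type*} {σ : ι → Set ℕ} {G : Type u} [Group G] [Finite G]

theorem cyc_norm (hσ : SigmaPartition σ) (hG : SigmaSoluble σ G) (hP : IsPSigmaT σ G) {i : ι}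
    (F : Subgroup G) [hF : F.Normal] (hFc : PN (σ i) (Nat.card F)) :
    ∀ r ∈ F, ∀ g, PN (σ i)ᶜ (orderOf g) → ∃ n : ℤ, g * r * g⁻¹ = r ^ n := by
  classical
  intro r hr g hg
  have h1 : SigmaPermutable σ F := by
    rw [sp_iff hσ]
    choose Y hY using fun i => hall_exists hσ i hG
    exact ⟨Y, hY, fun i x => perm_of_normal _ _⟩
  have h2 : SigmaPermutable σ (Subgroup.zpowers (⟨r, hr⟩ : F)) := by
    rw [sp_iff hσ]
    refine ⟨fun j => if j = i then ⊤ else ⊥, fun j => ?_, fun j x => ?_⟩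
    · by_cases hj : j = i
      · subst hj
        simp only [if_true]
        refine ⟨?_, ?_⟩
        · rw [Subgroup.card_top]; exact hFc
        · rw [Subgroup.index_top]; exact PN.one (π := (σ j)ᶜ)
      · simp only [hj, if_false]
        refine ⟨?_, ?_⟩
        · rw [Subgroup.card_bot]; exact PN.one
        · rw [Subgroup.index_bot]; exact sig_compl hσ hj hFc
    · by_cases hj : j = i
      · simp only [hj, if_true]
        have : ((⊤ : Subgroup F).map (MulAut.conj x).toMonoidHom) = ⊤ :=
          Subgroup.map_top_of_surjective _ (MulAut.conj x).surjective
        rw [this]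
        exact (perm_of_normal _ _).symm
      · simp only [hj, if_false]
        rw [Subgroup.map_bot]
        exact (perm_of_normal _ _).symm
  have h3 := hP F h1 _ h2
  rw [MonoidHom.map_zpowers, sp_iff hσ] at h3
  obtain ⟨Y, hY1, hY2⟩ := h3
  rw [norm_zpowers]
  refine norm_core (π := σ i) _ ?_ g hg
  intro p hp hpi hpG
  obtain ⟨j, hj⟩ := sig_exists hσ hp
  have hij : i ≠ j := by rintro rfl; exact hpi hj
  refine ⟨Y j, fun hd => (hY1 j).2 p hp hd hj, fun x y hy => ?_⟩
  have hZ := hall_conj (hY1 j) x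
  have hzy : x * y * x⁻¹ ∈ (Y j).map (MulAut.conj x).toMonoidHom := by
    rw [mem_conj_map]
    have : x⁻¹ * (x * y * x⁻¹) * x = y := by group
    rw [this]; exact hy
  have hle : Subgroup.zpowers r ≤ F := by rw [Subgroup.zpowers_le]; exact hr
  apply mem_norm_of_conj
  intro a ha
  obtain ⟨a', ha', z, hz, e⟩ := (hY2 j x).symm _ hzy a ha
  have e2 : x * y * x⁻¹ * a * (x * y * x⁻¹)⁻¹ = a' * (z * (x * y * x⁻¹)⁻¹) := by rw [e]; group
  have h5 : z * (x * y * x⁻¹)⁻¹ = 1 := by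
    refine eq_one_of_mem (π := σ i) hFc (sig_compl hσ hij hZ.1) ?_
      (Subgroup.mul_mem _ hz (Subgroup.inv_mem _ hzy))
    have e3 : z * (x * y * x⁻¹)⁻¹ = a'⁻¹ * (x * y * x⁻¹ * a * (x * y * x⁻¹)⁻¹) := by
      rw [e2]; group
    rw [e3]
    exact F.mul_mem (F.inv_mem (hle ha')) (hF.conj_mem _ (hle ha) _)
  rw [e2, h5, mul_one]
  exact ha'

end s2

section s3
variable {G : Type*} [Group G] [Finite G]

/-- power automorphisms of an abelian minimal normal subgroup are universal. -/
theorem universal_power (R : Subgroup G) [hR : R.Normal]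
    (hmin : ∀ M : Subgroup G, M.Normal → M ≤ R → M = ⊥ ∨ M = R)
    (hab : ∀ a ∈ R, ∀ b ∈ R, a * b = b * a) (g : G)
    (hn : ∀ r ∈ R, ∃ n : ℤ, g * r * g⁻¹ = r ^ n) :
    ∃ n : ℤ, ∀ r ∈ R, g * r * g⁻¹ = r ^ n := by
  by_cases hRb : R = ⊥
  · refine ⟨0, fun r hr => ?_⟩
    rw [hRb, Subgroup.mem_bot] at hr
    simp [hr]
  have hcard : Nat.card R ≠ 1 := fun h => hRb (Subgroup.card_eq_one.1 h)
  obtain ⟨p, hp, hpd⟩ := Nat.exists_prime_and_dvd hcard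
  have := Fact.mk hp
  obtain ⟨r0, hr0⟩ := exists_prime_orderOf_dvd_card' p hpd
  let M : Subgroup G :=
    { carrier := {r | r ∈ R ∧ r ^ p = 1}
      one_mem' := ⟨R.one_mem, one_pow p⟩
      mul_mem' := fun {a b} ha hb => ⟨R.mul_mem ha.1 hb.1, by
        rw [(show Commute a b from hab a ha.1 b hb.1).mul_pow, ha.2, hb.2, one_mul]⟩
      inv_mem' := fun {a} ha => ⟨R.inv_mem ha.1, by rw [inv_pow, ha.2, inv_one]⟩ }
  have hMn : M.Normal := ⟨fun m hm x => ⟨hR.conj_mem m hm.1 x, by rw [conj_pow, hm.2]; group⟩⟩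
  have hr0p : r0.1 ^ p = 1 := by
    have := pow_orderOf_eq_one r0
    rw [hr0] at this
    exact congrArg Subtype.val this
  have hr0M : r0.1 ∈ M := ⟨r0.2, hr0p⟩
  have hr01 : r0.1 ≠ 1 := by
    intro h
    have h' : r0 = 1 := Subtype.ext h
    rw [h', orderOf_one] at hr0
    exact hp.one_lt.ne hr0
  have hMR : M = R := by
    rcases hmin M hMn (fun m hm => hm.1) with h | h
    · rw [h, Subgroup.mem_bot] at hr0M
      exact absurd hr0M hr01
    · exact h
  have hexp : ∀ r ∈ R, r ^ (p : ℤ) = 1 := by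
    intro r hr
    rw [← hMR] at hr
    rw [zpow_natCast]
    exact hr.2
  have key : ∀ r ∈ R, ∀ (H : Subgroup G) (k : ℤ), r ^ k ∈ H → ¬ (p : ℤ) ∣ k → r ∈ H := by
    intro r hr H k hk hpk
    obtain ⟨u, v, huv⟩ := ((Nat.prime_iff_prime_int.1 hp).coprime_iff_not_dvd.2 hpk)
    have : r = (r ^ k) ^ v := by
      rw [← zpow_mul]
      conv_lhs => rw [← zpow_one r, ← huv, zpow_add, mul_comm u, zpow_mul, hexp r hr, one_zpow, one_mul]
      rw [mul_comm]
    rw [this]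
    exact H.zpow_mem hk v
  have hdvd : ∀ r ∈ R, ∀ k : ℤ, (p : ℤ) ∣ k → r ^ k = 1 := by
    rintro r hr k ⟨l, rfl⟩
    rw [zpow_mul, hexp r hr, one_zpow]
  obtain ⟨n, hn0⟩ := hn r0 r0.2
  refine ⟨n, fun s hs => ?_⟩
  by_cases hs0 : s ∈ Subgroup.zpowers r0.1
  · obtain ⟨k, rfl⟩ := Subgroup.mem_zpowers_iff.1 hs0
    rw [← conj_zpow, hn0, ← zpow_mul, ← zpow_mul, mul_comm]
  · obtain ⟨m, hm⟩ := hn s hs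
    obtain ⟨l, hl⟩ := hn (r0.1 * s) (R.mul_mem r0.2 hs)
    have hc : Commute r0.1 s := hab _ r0.2 _ hs
    have e1 : r0.1 ^ n * s ^ m = r0.1 ^ l * s ^ l := by
      rw [← hc.mul_zpow, ← hl, ← hn0, ← hm]; group
    have e2 : s ^ (m - l) = r0.1 ^ (l - n) := by
      rw [zpow_sub, sub_eq_neg_add, zpow_add, zpow_neg, mul_inv_eq_iff_eq_mul, mul_assoc, ← e1]
      group
    have h1 : (p : ℤ) ∣ m - l := by
      by_contra hcon
      refine hs0 (key s hs _ (m - l) ?_ hcon)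
      rw [e2]
      exact Subgroup.zpow_mem _ (Subgroup.mem_zpowers _) _
    have h2 : (p : ℤ) ∣ l - n := by
      by_contra hcon
      rw [hdvd s hs _ h1] at e2
      have := key r0.1 r0.2 ⊥ (l - n) (by rw [← e2]; exact Subgroup.one_mem _) hcon
      exact hr01 (Subgroup.mem_bot.1 this)
    have h3 : s ^ (m - n) = 1 := hdvd s hs _ (by
      have := dvd_add h1 h2
      simpa using this)
    rw [hm]
    rw [zpow_sub, mul_inv_eq_one] at h3
    exact h3

end s3

theorem claim1_aux {ι : Type*} {σ : ι → Set ℕ} (hσ : SigmaPartition σ) (i : ι) (n : ℕ) :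
    ∀ (G : Type u) [Group G] [Finite G], Nat.card G = n → SigmaSoluble σ G →
      IsPSigmaT σ G → LP (σ i) G := by
  induction n using Nat.strong_induction_on with
  | _ n ih =>
    intro G _ _ hn hG hP
    by_cases hO' : ∃ N : Subgroup G, N.Normal ∧ PN (σ i)ᶜ (Nat.card N) ∧ N ≠ ⊥
    · obtain ⟨N, hN, hNc, hN1⟩ := hO'
      obtain ⟨k, M, hM, hM1, hMN, hMc⟩ := SS_min hG N hN1
      have hf := QuotientGroup.mk'_surjective M
      refine LP.lift (ih _ (hn ▸ card_quot_lt M hM1) (G ⧸ M) rfl (SS_map hG _ hf)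
        (PsT_map hσ _ hf (k := k) (by rw [ker_mk'_card]; exact hMc) hP)) _ hf ?_
      rw [ker_mk'_card]
      exact hNc.dvd (Subgroup.card_dvd_of_le hMN)
    have hO : ∀ N : Subgroup G, N.Normal → PN (σ i)ᶜ (Nat.card N) → N = ⊥ := by
      intro N h1 h2
      by_contra h3
      exact hO' ⟨N, h1, h2, h3⟩
    by_cases htop : (⊤ : Subgroup G) = ⊥
    · have : Subsingleton G := (Subgroup.subsingleton_iff.1 ⟨fun a b => by
        rw [eq_bot_iff.2 (le_top.trans htop.le : a ≤ ⊥),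
          eq_bot_iff.2 (le_top.trans htop.le : b ≤ ⊥)]⟩)
      refine ⟨⊥, ⊤, inferInstance, inferInstance, bot_le, ?_, ?_, ?_, fun h g _ _ => ⟨0, ?_⟩⟩
      · rw [Subgroup.card_bot]; exact PN.one
      · rw [htop, Subgroup.relIndex_self]; exact PN.one
      · rw [Subgroup.index_top]; exact PN.one
      · exact Subgroup.mem_bot.2 (Subsingleton.elim _ _)
    obtain ⟨k, R, hR, hR1, -, hRc, hmin⟩ := SS_minimal hG ⊤ htop
    have hki : k = i := by
      by_contra hki
      exact hR1 (hO R hR (sig_compl hσ (Ne.symm hki) hRc))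
    subst hki
    obtain ⟨F, hF, hFc, hFm⟩ := exists_core (σ k) G
    obtain ⟨f, hfdef⟩ : ∃ f, f = QuotientGroup.mk' R := ⟨_, rfl⟩
    have hf : Function.Surjective f := hfdef ▸ QuotientGroup.mk'_surjective R
    have hker : f.ker = R := hfdef ▸ QuotientGroup.ker_mk' R
    have hfR : ∀ x, f x = 1 ↔ x ∈ R := fun x => by rw [← MonoidHom.mem_ker, hker]
    obtain ⟨A, B, hA, hB, hAB, h1, h2, h3, h4⟩ := ih _ (hn ▸ card_quot_lt R hR1) (G ⧸ R) rfl
      (SS_map hG f hf) (PsT_map hσ f hf (k := k) (by rw [hker]; exact hRc) hP)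
    have hFmap : PN (σ k) (Nat.card (F.map f)) := hFc.dvd (Subgroup.card_map_dvd F f)
    have fact0 : ∀ a, f a ∈ A → PN (σ k)ᶜ (orderOf a) → (∀ r ∈ R, a * r = r * a) → a = 1 := by
      intro a haA hao har
      suffices haF : a ∈ F from eq_one_of_PN (elem_of_card hFc haF) hao
      refine HH hσ hG k hO F hFc hFm a fun x hx => ?_
      set r := a * x * a⁻¹ * x⁻¹ with hr
      have hrF : r ∈ F := F.mul_mem (hF.conj_mem x hx a) (F.inv_mem hx)
      have hrR : r ∈ R := by
        rw [← hfR]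
        refine eq_one_of_mem hFmap h1 (Subgroup.mem_map_of_mem f hrF) ?_
        have : f r = f a * (f x * (f a)⁻¹ * (f x)⁻¹) := by
          rw [hr]; simp only [map_mul, map_inv]; group
        rw [this]
        exact A.mul_mem haA (hA.conj_mem _ (A.inv_mem haA) _)
      have hcm : Commute r⁻¹ a := Commute.inv_left (Commute.symm (har r hrR))
      have e1 : x * a * x⁻¹ = r⁻¹ * a := by rw [hr]; group
      have e2 : r⁻¹ ^ orderOf a = 1 := by
        have : (x * a * x⁻¹) ^ orderOf a = 1 := by rw [conj_pow, pow_orderOf_eq_one]; group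
        rw [e1, hcm.mul_pow, pow_orderOf_eq_one, mul_one] at this
        exact this
      have hr1 : r⁻¹ = 1 := eq_one_of_PN (elem_of_card hRc (R.inv_mem hrR))
        (hao.dvd (orderOf_dvd_of_pow_eq_one e2))
      have hr2 : a * x * a⁻¹ * x⁻¹ = 1 := inv_eq_one.1 hr1
      exact (mul_inv_eq_iff_eq_mul.1 (mul_inv_eq_one.1 hr2))
    have fact1 : ∀ a, f a ∈ A → (∀ r ∈ R, a * r = r * a) → f a = 1 := by
      intro a haA har
      obtain ⟨t, ht1, ht2⟩ := lift_elem (σ k)ᶜ f a (elem_of_card h1 haA)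
      rw [← ht1, fact0 (a ^ t) (by rw [ht1]; exact haA) ht2
        (fun r hr => (Commute.pow_left (har r hr : Commute a r) t).eq), map_one]
    have hcyc := cyc_norm hσ hG hP R hRc
    have hcomm : ∀ a ∈ A, ∀ b ∈ B, a * b = b * a := by
      intro a ha b hb
      obtain ⟨a, rfl⟩ := hf a
      obtain ⟨b, rfl⟩ := hf b
      obtain ⟨t, ht1, ht2⟩ := lift_elem (σ k)ᶜ f a (elem_of_card h1 ha)
      rw [← ht1]
      rw [← ht1] at ha
      rcases dichotomy R hRc hmin hcyc with hab | hcen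
      · obtain ⟨n, hn⟩ := universal_power R hmin hab (a ^ t) (fun r hr => hcyc r hr _ ht2)
        generalize a ^ t = g at *
        have hc1 : f (g * b * g⁻¹ * b⁻¹) = 1 := by
          apply fact1
          · have : f (g * b * g⁻¹ * b⁻¹) = f g * (f b * (f g)⁻¹ * (f b)⁻¹) := by
              simp only [map_mul, map_inv]; group
            rw [this]
            exact A.mul_mem ha (hA.conj_mem _ (A.inv_mem ha) _)
          · intro r hr
            set s := (b * g⁻¹ * b⁻¹) * r * (b * g⁻¹ * b⁻¹)⁻¹ with hs
            have hsR : s ∈ R := hR.conj_mem r hr _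
            have hsn : r = s ^ n := by
              have h5 := hn (b⁻¹ * s * b⁻¹⁻¹) (hR.conj_mem s hsR _)
              rw [conj_zpow] at h5
              have h6 : s ^ n = b * (b⁻¹ * s ^ n * b⁻¹⁻¹) * b⁻¹ := by group
              rw [h6, ← h5, hs]; group
            have h7 : g * s * g⁻¹ = r := by rw [hn s hsR, ← hsn]
            calc g * b * g⁻¹ * b⁻¹ * r = g * s * g⁻¹ * (g * b * g⁻¹ * b⁻¹) := by rw [hs]; group
              _ = _ := by rw [h7]
        simp only [map_mul, map_inv] at hc1
        exact (mul_inv_eq_iff_eq_mul.1 (mul_inv_eq_one.1 hc1))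
      · rw [fact1 (a ^ t) ha (fun r hr => hcen _ ht2 r hr), one_mul, mul_one]
    obtain ⟨H, hH1, hH2, hH3, hH4⟩ := central_hall hAB hcomm h1 h2
    have hHc : PN (σ k) (Nat.card (H.comap f)) := by
      rw [card_comap_surj f hf, hker]; exact hH3.mul hRc
    have hHi : PN (σ k)ᶜ (H.comap f).index := by
      rw [Subgroup.index_comap_of_surjective _ hf, ← Subgroup.relIndex_mul_index hH2]
      exact hH4.mul h3
    refine ⟨⊥, H.comap f, inferInstance, inferInstance, bot_le, ?_, ?_, hHi, ?_⟩
    · rw [Subgroup.card_bot]; exact PN.one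
    · rw [Subgroup.relIndex_bot_left]; exact hHc
    · intro h g hh hg
      have hmem : h ∈ H.comap f := mem_of_index hHi hh
      obtain ⟨n, hn⟩ := cyc_norm hσ hG hP (H.comap f) hHc h hmem g hg
      exact ⟨n, by rw [Subgroup.mem_bot, mul_inv_eq_one]; exact hn⟩

theorem claim1 {ι : Type*} {σ : ι → Set ℕ} (hσ : SigmaPartition σ) {G : Type u} [Group G]
    [Finite G] (hG : SigmaSoluble σ G) (hP : IsPSigmaT σ G) : ∀ i, LP (σ i) G :=
  fun i => claim1_aux hσ i _ G rfl hG hP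

end PST

namespace PST

set_option linter.all false
set_option linter.unusedVariables false
set_option linter.unusedSectionVars false

universe u

section s1
variable {ι : Type*} {σ : ι → Set ℕ} {G : Type u} [Group G] [Finite G]

theorem eq_of_hall_le {π : Set ℕ} {X Y : Subgroup G} (hX : PN π (Nat.card X))
    (hY : PN πᶜ (Y.relIndex X)) (h : Y ≤ X) : Y = X := by
  apply le_antisymm h
  rw [← Subgroup.relIndex_eq_one]
  exact PN.eq_one (hX.dvd (Subgroup.relIndex_dvd_card _ _)) hY

theorem Perm.cover {K X : Subgroup G} (h : Perm K X) :
    ∀ l ∈ K ⊔ X, ∃ k ∈ K, ∃ x ∈ X, l = k * x := by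
  let S : Subgroup G :=
    { carrier := {g | ∃ k ∈ K, ∃ x ∈ X, g = k * x}
      one_mem' := ⟨1, K.one_mem, 1, X.one_mem, by simp⟩
      mul_mem' := by
        rintro _ _ ⟨k, hk, x, hx, rfl⟩ ⟨k', hk', x', hx', rfl⟩
        obtain ⟨k2, hk2, x2, hx2, e⟩ := h.symm x hx k' hk'
        refine ⟨k * k2, K.mul_mem hk hk2, x2 * x', X.mul_mem hx2 hx', ?_⟩
        calc k * x * (k' * x') = k * (x * k') * x' := by group
          _ = _ := by rw [e]; group
      inv_mem' := by
        rintro _ ⟨k, hk, x, hx, rfl⟩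
        obtain ⟨k2, hk2, x2, hx2, e⟩ := h.symm x⁻¹ (X.inv_mem hx) k⁻¹ (K.inv_mem hk)
        exact ⟨k2, hk2, x2, hx2, by rw [mul_inv_rev, e]⟩ }
  have : K ⊔ X ≤ S := sup_le (fun k hk => ⟨k, hk, 1, X.one_mem, by simp⟩)
    (fun x hx => ⟨1, K.one_mem, x, hx, by simp⟩)
  intro l hl
  exact this hl

def Inv (σ : ι → Set ℕ) (K : Subgroup G) : Prop :=
  ∀ i, ∀ X : Subgroup G, IsHallSubgroup (σ i) X → PN (σ i)ᶜ (X.relIndex K)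

theorem sp_inv (hσ : SigmaPartition σ) (hG : SigmaSoluble σ G) (hL : ∀ k, LP (σ k) G)
    {K : Subgroup G} (hK : SigmaPermutable σ K) : Inv σ K := by
  rw [sp_iff hσ] at hK
  obtain ⟨Y, h1, h2⟩ := hK
  intro i X hX
  obtain ⟨x, rfl⟩ := hall_conjugate hσ hG hL (h1 i) hX
  rw [← relIndex_eq_of_cover (le_sup_left) (h2 i x).cover]
  exact PN.dvd (π := (σ i)ᶜ) hX.2 (Subgroup.relIndex_dvd_index_of_le le_sup_right)

theorem Inv.trans {H : Subgroup G} (hH : Inv σ H) {K : Subgroup H} (hK : Inv σ K) :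
    Inv σ (K.map H.subtype) := by
  intro i X hX
  rw [← Subgroup.relIndex_comap]
  refine hK i _ ⟨?_, hH i X hX⟩
  exact PN.dvd hX.1 (Subgroup.card_comap_dvd_of_injective _ _ H.subtype_injective)

theorem Inv.sub (hσ : SigmaPartition σ) (hG : SigmaSoluble σ G) (hL : ∀ k, LP (σ k) G)
    {K M : Subgroup G} (hK : Inv σ K) (hKM : K ≤ M) : Inv σ (K.subgroupOf M) := by
  intro i Z hZ
  obtain ⟨X0, hX0⟩ := hall_exists hσ i hG
  have hZc : PN (σ i) (Nat.card (Z.map M.subtype)) := PN.dvd hZ.1 (Subgroup.card_map_dvd Z _)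
  obtain ⟨g, hg⟩ := dominance hσ hG hL hZc hX0
  have hX := hall_conj hX0 g
  have e : Z = (X0.map (MulAut.conj g).toMonoidHom).subgroupOf M := by
    have hle : Z ≤ (X0.map (MulAut.conj g).toMonoidHom).subgroupOf M := by
      rw [Subgroup.subgroupOf, ← Subgroup.map_le_iff_le_comap]; exact hg
    apply eq_of_hall_le (π := σ i) _ _ hle
    · exact PN.dvd hX.1 (Subgroup.card_comap_dvd_of_injective _ _ M.subtype_injective)
    · exact PN.dvd (π := (σ i)ᶜ) hZ.2 (Subgroup.relIndex_dvd_index_of_le hle)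
  rw [e, Subgroup.relIndex_subgroupOf hKM]
  exact hK i _ hX

theorem Inv.map (hσ : SigmaPartition σ) (hG : SigmaSoluble σ G) (hL : ∀ k, LP (σ k) G)
    {Q : Type u} [Group Q] [Finite Q] (f : G →* Q) (hf : Function.Surjective f)
    {K : Subgroup G} (hK : Inv σ K) : Inv σ (K.map f) := by
  intro i Z hZ
  obtain ⟨X, hX⟩ := hall_exists hσ i hG
  obtain ⟨g, hg⟩ := hall_conjugate hσ (SS_map hG f hf) (fun k => (hL k).map f hf)
    (hall_map hX f hf) hZ
  obtain ⟨g, rfl⟩ := hf g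
  have hX' := hall_conj hX g
  have e : Z = (X.map (MulAut.conj g).toMonoidHom).map f := by
    rw [hg, Subgroup.map_map, Subgroup.map_map]
    congr 1
    ext x
    simp
  rw [e, ← Subgroup.relIndex_comap]
  exact (hK i _ hX').dvd (Subgroup.relIndex_dvd_of_le_left _ (Subgroup.le_comap_map f _))

end s1

theorem claim2_aux {ι : Type*} {σ : ι → Set ℕ} (hσ : SigmaPartition σ) (i : ι) (n : ℕ) :
    ∀ (G : Type u) [Group G] [Finite G], Nat.card G = n → SigmaSoluble σ G →
      (∀ k, LP (σ k) G) → ∀ K X : Subgroup G, Inv σ K → IsHallSubgroup (σ i) X →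
      PN (σ i) (K.relIndex (K ⊔ X)) := by
  induction n using Nat.strong_induction_on with
  | _ n ih =>
    intro G _ _ hn hG hL K X hK hX
    by_cases hM : K ⊔ X = ⊤
    swap
    · have h := ih _ (hn ▸ card_sub_lt _ hM) ↥(K ⊔ X) rfl
        (SS_of_injective hG _ (Subgroup.subtype_injective _))
        (fun k => (hL k).of_injective _ (Subgroup.subtype_injective _))
        (K.subgroupOf (K ⊔ X)) (X.subgroupOf (K ⊔ X)) (hK.sub hσ hG hL le_sup_left)
        ⟨PN.dvd hX.1 (Subgroup.card_comap_dvd_of_injective _ _ (Subgroup.subtype_injective _)),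
          PN.dvd (π := (σ i)ᶜ) hX.2 (Subgroup.relIndex_dvd_index_of_le le_sup_right)⟩
      rw [← Subgroup.subgroupOf_sup le_sup_left le_sup_right,
        Subgroup.relIndex_subgroupOf le_rfl] at h
      exact h
    have b0 : ∀ N : Subgroup G, N.Normal → N ≠ ⊥ → PN (σ i) (K ⊔ N).index := by
      intro N hN hN1
      have hf := QuotientGroup.mk'_surjective N
      have h := ih _ (hn ▸ card_quot_lt N hN1) (G ⧸ N) rfl (SS_map hG _ hf)
        (fun k => (hL k).map _ hf) (K.map (QuotientGroup.mk' N)) (X.map (QuotientGroup.mk' N))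
        (hK.map hσ hG hL _ hf) (hall_map hX _ hf)
      rw [← Subgroup.map_sup, hM, ← Subgroup.relIndex_comap, Subgroup.comap_map_eq,
        QuotientGroup.ker_mk', Subgroup.relIndex_top_right] at h
      exact h
    have b1 : ∀ N : Subgroup G, N.Normal → K.index = K.relIndex N * (K ⊔ N).index := by
      intro N hN
      rw [← relIndex_sup_normal, Subgroup.relIndex_mul_index le_sup_left]
    rw [hM, Subgroup.relIndex_top_right]
    by_cases htop : (⊤ : Subgroup G) = ⊥
    · have : K = ⊤ := by
        rw [eq_top_iff, htop]; exact bot_le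
      rw [this, Subgroup.index_top]; exact PN.one
    obtain ⟨j, R, hR, hR1, -, hRc⟩ := SS_min hG ⊤ htop
    by_cases hji : j = i
    · subst hji
      rw [b1 R hR]
      exact (hRc.dvd (Subgroup.relIndex_dvd_card _ _)).mul (b0 R hR hR1)
    by_cases hO' : ∃ N : Subgroup G, N.Normal ∧ PN (σ j)ᶜ (Nat.card N) ∧ N ≠ ⊥
    · obtain ⟨N, hN, hNc, hN1⟩ := hO'
      intro p hp hd
      have hd1 := hd
      have hd2 := hd
      rw [b1 R hR, hp.dvd_mul] at hd1
      rw [b1 N hN, hp.dvd_mul] at hd2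
      rcases hd1 with hd1 | hd1
      · rcases hd2 with hd2 | hd2
        · exact absurd (hRc p hp (hd1.trans (Subgroup.relIndex_dvd_card _ _)))
            (hNc p hp (hd2.trans (Subgroup.relIndex_dvd_card _ _)))
        · exact b0 N hN hN1 p hp hd2
      · exact b0 R hR hR1 p hp hd1
    have hO : ∀ N : Subgroup G, N.Normal → PN (σ j)ᶜ (Nat.card N) → N = ⊥ := by
      intro N h1 h2
      by_contra h3
      exact hO' ⟨N, h1, h2, h3⟩
    obtain ⟨A, F, hA, hF, hAB, h1, h2, h3, h4⟩ := hL j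
    have hAb := hO A hA h1
    subst hAb
    rw [Subgroup.relIndex_bot_left] at h2
    have h5 : ∀ h ∈ F, ∀ g : G, PN (σ j)ᶜ (orderOf g) → ∃ n : ℤ, g * h * g⁻¹ = h ^ n := by
      intro h hh g hg
      obtain ⟨n, hn⟩ := h4 h g (elem_of_card h2 hh) hg
      exact ⟨n, mul_inv_eq_one.1 (Subgroup.mem_bot.1 hn)⟩
    have hKF : (K ⊓ F).Normal := by
      rw [← Subgroup.normalizer_eq_top_iff, eq_top_iff, ← hM]
      apply sup_le
      · intro k hk
        apply mem_norm_of_conj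
        intro a ha
        exact ⟨K.mul_mem (K.mul_mem hk ha.1) (K.inv_mem hk), hF.conj_mem _ ha.2 k⟩
      · intro x hx
        apply mem_norm_of_conj
        intro a ha
        obtain ⟨n, hn⟩ := h5 a ha.2 x (sig_compl hσ hji (elem_of_card hX.1 hx))
        rw [hn]
        exact Subgroup.zpow_mem _ ha n
    by_cases hKF1 : K ⊓ F = ⊥
    swap
    · have := b0 _ hKF hKF1
      rwa [sup_eq_left.2 (inf_le_left : K ⊓ F ≤ K)] at this
    have hmem1 : ∀ x, x ∈ K → x ∈ F → x = 1 := by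
      intro x hx hx'
      have : x ∈ K ⊓ F := ⟨hx, hx'⟩
      rw [hKF1] at this
      exact Subgroup.mem_bot.1 this
    set C := Subgroup.centralizer (F : Set G) with hC
    have hintl : ∀ k, k ≠ j → ∀ X' : Subgroup G, IsHallSubgroup (σ k) X' → X' ⊓ K ≤ C := by
      intro k hkj X' hX' x hx
      rw [hC, Subgroup.mem_centralizer_iff]
      intro v hv
      set Z := X'.map (MulAut.conj v).toMonoidHom with hZdef
      have hZ : IsHallSubgroup (σ k) Z := hall_conj hX' v
      set D := (X' ⊔ F) ⊓ K with hD
      have hDc : PN (σ k) (Nat.card D) := by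
        have e1 : F.relIndex D = Nat.card D := by
          rw [← Subgroup.inf_relIndex_right]
          have : F ⊓ D = ⊥ := by
            rw [eq_bot_iff]
            rintro y ⟨hy1, hy2⟩
            exact hmem1 y hy2.2 hy1
          rw [this, Subgroup.relIndex_bot_left]
        rw [← e1]
        refine PN.dvd (PN.dvd hX'.1 (Subgroup.relIndex_dvd_card F X')) ?_
        rw [← Subgroup.relIndex_sup_right (K := F) (H := X')]
        exact relIndex_dvd_right F inf_le_left
      have hZD : Z ⊓ K ≤ D := by
        refine inf_le_inf ?_ le_rfl
        intro z hz
        rw [hZdef, mem_conj_map] at hz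
        have e2 : z = v * (v⁻¹ * z * v) * v⁻¹ := by group
        rw [e2]
        have hv' : v ∈ X' ⊔ F := (le_sup_right : F ≤ X' ⊔ F) hv
        exact Subgroup.mul_mem _ (Subgroup.mul_mem _ hv' ((le_sup_left : X' ≤ X' ⊔ F) hz))
          (Subgroup.inv_mem _ hv')
      have e3 : Z ⊓ K = D := by
        apply eq_of_hall_le hDc _ hZD
        refine PN.dvd (hK k Z hZ) ?_
        rw [← Subgroup.inf_relIndex_right Z K,
          ← Subgroup.relIndex_mul_relIndex (Z ⊓ K) D K hZD inf_le_right]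
        exact dvd_mul_right _ _
      have hxD : x ∈ D := ⟨(le_sup_left : X' ≤ X' ⊔ F) hx.1, hx.2⟩
      rw [← e3] at hxD
      have hxZ : x ∈ Z := hxD.1
      rw [hZdef, mem_conj_map] at hxZ
      have h6 : x⁻¹ * (v⁻¹ * x * v) = 1 := by
        refine eq_one_of_mem (π := σ j) (K := X') h2 (sig_compl hσ (Ne.symm hkj) hX'.1) ?_
          (X'.mul_mem (X'.inv_mem hx.1) hxZ)
        have e4 : x⁻¹ * (v⁻¹ * x * v) = (x⁻¹ * v⁻¹ * x⁻¹⁻¹) * v := by group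
        rw [e4]
        exact F.mul_mem (hF.conj_mem _ (F.inv_mem hv) _) hv
      have h7 : x = v⁻¹ * x * v := by rw [← inv_mul_eq_one]; exact h6
      calc v * x = v * (v⁻¹ * x * v) := by rw [← h7]
        _ = x * v := by group
    have hKC : K ≤ C := by
      rw [← Subgroup.relIndex_eq_one]
      by_contra hne
      obtain ⟨p, hp, hpd⟩ := Nat.exists_prime_and_dvd hne
      obtain ⟨k, hk⟩ := sig_exists hσ hp
      by_cases hkj : k = j
      · subst hkj
        have := Fact.mk hp
        obtain ⟨x, hx⟩ := exists_prime_orderOf_dvd_card' p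
          (hpd.trans (Subgroup.relIndex_dvd_card C K))
        have hxo : PN (σ k) (orderOf x.1) := by
          rw [Subgroup.orderOf_coe, hx]
          intro q hq hqp
          rwa [(Nat.prime_dvd_prime_iff_eq hq hp).1 hqp]
        have hx1 := hmem1 x.1 x.2 (mem_of_index h3 hxo)
        have hx2 : x = 1 := Subtype.ext hx1
        rw [hx2, orderOf_one] at hx
        exact hp.one_lt.ne hx
      · obtain ⟨X', hX'⟩ := hall_exists hσ k hG
        have h8 : C.relIndex K ∣ X'.relIndex K := by
          rw [← Subgroup.inf_relIndex_right X' K]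
          exact Subgroup.relIndex_dvd_of_le_left K (hintl k hkj X' hX')
        exact hK k X' hX' p hp (hpd.trans h8) hk
    have hKb : K = ⊥ := by
      rw [eq_bot_iff]
      intro x hx
      refine Subgroup.mem_bot.2 (hmem1 x hx ?_)
      refine HH hσ hG j hO F h2 (fun N hN hNc => normal_le_hall hNc h3) x fun v hv => ?_
      exact (Subgroup.mem_centralizer_iff.1 (hKC hx) v hv).symm
    rw [hKb, bot_sup_eq] at hM
    rw [hKb, Subgroup.index_bot]
    have := hX.1
    rw [hM, Subgroup.card_top] at this
    exact this

theorem claim2 {ι : Type*} {σ : ι → Set ℕ} (hσ : SigmaPartition σ) {G : Type u} [Group G]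
    [Finite G] (hG : SigmaSoluble σ G) (hL : ∀ k, LP (σ k) G) : IsPSigmaT σ G := by
  intro H hH K hK
  have hinj : Function.Injective H.subtype := Subgroup.subtype_injective _
  have h1 := sp_inv hσ hG hL hH
  have h2 := sp_inv hσ (SS_of_injective hG _ hinj) (fun k => (hL k).of_injective _ hinj) hK
  have h3 := h1.trans h2
  rw [sp_iff hσ]
  choose Y hY using fun i => hall_exists hσ i hG
  refine ⟨Y, hY, fun i x => ?_⟩
  have hX := hall_conj (hY i) x
  have h4 := claim2_aux hσ i _ G rfl hG hL _ _ h3 hX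
  have h5 := cover_of_coprime (le_sup_left) (le_sup_right) (h4.coprime
    (PN.dvd (π := (σ i)ᶜ) hX.2 (Subgroup.relIndex_dvd_index_of_le
      (le_sup_right : _ ≤ K.map H.subtype ⊔ (Y i).map (MulAut.conj x).toMonoidHom))))
  intro a ha b hb
  obtain ⟨b', hb', a', ha', e⟩ := h5 (a * b) (Subgroup.mul_mem _
    ((le_sup_left : K.map H.subtype ≤ _) ha) ((le_sup_right : (Y i).map _ ≤ _) hb))
  exact ⟨b', hb', a', ha', e⟩

end PST

namespace PST

set_option linter.all false
set_option linter.unusedVariables false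
set_option linter.unusedSectionVars false

universe u

section s1
variable {ι : Type*} {σ : ι → Set ℕ} {G : Type u} [Group G] [Finite G]

def Cov (V T : Subgroup G) : Prop := ∀ x, ∃ v ∈ V, ∃ t ∈ T, x = v * t

theorem cov_iff {V T : Subgroup G} : (V : Set G) * (T : Set G) = Set.univ ↔ Cov V T := by
  constructor
  · intro h x
    have : x ∈ (V : Set G) * (T : Set G) := by rw [h]; trivial
    obtain ⟨v, hv, t, ht, e⟩ := this
    exact ⟨v, hv, t, ht, e.symm⟩
  · intro h
    rw [Set.eq_univ_iff_forall]
    intro x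
    obtain ⟨v, hv, t, ht, e⟩ := h x
    exact ⟨v, hv, t, ht, e.symm⟩

/-- `V` is a maximal subgroup of `P`. -/
def IsMax (V P : Subgroup G) : Prop := V < P ∧ ∀ W : Subgroup G, V < W → W ≤ P → W = P

def Hyp (σ : ι → Set ℕ) (G : Type u) [Group G] : Prop :=
  ∀ p : ℕ, p.Prime → p ∣ Nat.card G → ∀ (P : Sylow p G) (V : Subgroup G), V < ↑P →
    (∀ W : Subgroup G, V < W → W ≤ ↑P → W = ↑P) →
    ∃ T : Subgroup G, Cov V T ∧ SigmaSoluble σ T ∧ ∀ i, LP (σ i) T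

theorem exists_max {S P : Subgroup G} (h : S < P) : ∃ V, S ≤ V ∧ IsMax V P := by
  obtain ⟨V, hV⟩ := (Set.toFinite {V : Subgroup G | S ≤ V ∧ V < P}).exists_maximal ⟨S, le_rfl, h⟩
  refine ⟨V, hV.prop.1, hV.prop.2, fun W hVW hWP => ?_⟩
  by_contra hne
  exact hVW.not_ge (hV.le_of_ge ⟨hV.prop.1.trans hVW.le, lt_of_le_of_ne hWP hne⟩ hVW.le)

theorem CS1 {P N : Subgroup G} (h : ∀ V, IsMax V P → ∃ T, Cov V T ∧ P ⊓ T ≤ N) : P ≤ N := by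
  by_contra hcon
  have hlt : P ⊓ N < P := lt_of_le_of_ne inf_le_left (fun e => hcon (inf_eq_left.1 e))
  obtain ⟨V, hSV, hV⟩ := exists_max hlt
  obtain ⟨T, hT, hTN⟩ := h V hV
  apply hV.1.not_ge
  intro x hx
  obtain ⟨v, hv, t, ht, e⟩ := hT x
  have htP : t ∈ P := by
    have : t = v⁻¹ * x := by rw [e]; group
    rw [this]
    exact P.mul_mem (P.inv_mem (hV.1.le hv)) hx
  rw [e]
  exact V.mul_mem hv (hSV ⟨htP, hTN ⟨htP, ht⟩⟩)

theorem CS2 {P N : Subgroup G}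
    (h : ∀ V, IsMax V P → ∃ T, Cov V T ∧ ∃ g : G, ∀ t ∈ T, g⁻¹ * t * g ∈ N) : P ≤ N := by
  apply CS1
  intro V hV
  obtain ⟨T, hT, g, hg⟩ := h V hV
  obtain ⟨v, hv, t, ht, e⟩ := hT g⁻¹
  have hn := hg t ht
  set n := g⁻¹ * t * g with hndef
  refine ⟨T.map (MulAut.conj v).toMonoidHom, ?_, ?_⟩
  · intro x
    obtain ⟨w, hw, s, hs, e2⟩ := hT (x * v)
    refine ⟨w * v⁻¹, V.mul_mem hw (V.inv_mem hv), v * s * v⁻¹, ?_, ?_⟩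
    · rw [mem_conj_map]
      have : v⁻¹ * (v * s * v⁻¹) * v = s := by group
      rw [this]; exact hs
    · have : x = (x * v) * v⁻¹ := by group
      rw [this, e2]; group
  · rintro y ⟨-, hy⟩
    have hy' : y ∈ T.map (MulAut.conj v).toMonoidHom := hy
    rw [mem_conj_map] at hy'
    have h1 := hg _ hy'
    have e3 : v = g⁻¹ * t⁻¹ := by rw [e]; group
    have e4 : y = n⁻¹ * (g⁻¹ * (v⁻¹ * y * v) * g) * n := by
      rw [hndef, e3]; group
    rw [e4]
    exact N.mul_mem (N.mul_mem (N.inv_mem hn) h1) hn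

theorem sylow_PN {π : Set ℕ} {p : ℕ} (hp : p.Prime) (hπ : p ∈ π) (P : Sylow p G) :
    PN π (Nat.card (P : Subgroup G)) := by
  have := Fact.mk hp
  rw [Sylow.card_eq_multiplicity]
  intro q hq hd
  rwa [(Nat.prime_dvd_prime_iff_eq hq hp).1 (hq.dvd_of_dvd_pow hd)]

theorem cov_index {π : Set ℕ} {p : ℕ} (hp : p.Prime) (hπ : p ∈ π) (P : Sylow p G) {V T : Subgroup G}
    (hV : V ≤ P) (hT : Cov V T) : PN π T.index := by
  have : T.index = T.relIndex V := by
    rw [← Subgroup.relIndex_top_right]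
    exact relIndex_eq_of_cover le_top (fun l _ => hT l)
  rw [this]
  exact (sylow_PN hp hπ P).dvd ((Subgroup.relIndex_dvd_card _ _).trans (Subgroup.card_dvd_of_le hV))

theorem Hyp.map (hG : Hyp σ G) {Q : Type u} [Group Q] [Finite Q] (f : G →* Q)
    (hf : Function.Surjective f) : Hyp σ Q := by
  intro p hp hpd P' V' hV1 hV2
  have := Fact.mk hp
  obtain ⟨P, rfl⟩ := Sylow.mapSurjective_surjective hf p P'
  rw [Sylow.coe_mapSurjective] at hV1 hV2
  have hpG : p ∣ Nat.card G := hpd.trans (Subgroup.card_dvd_of_surjective f hf)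
  have hVmap : ∀ v ∈ V', ∃ x ∈ (P : Subgroup G) ⊓ V'.comap f, f x = v := by
    intro v hv
    obtain ⟨x, hx, rfl⟩ := hV1.le hv
    exact ⟨x, ⟨hx, hv⟩, rfl⟩
  obtain ⟨T, hT1, hT2, hT3⟩ := hG p hp hpG P ((P : Subgroup G) ⊓ V'.comap f) (by
      refine lt_of_le_of_ne inf_le_left (fun e => hV1.not_ge ?_)
      rw [Subgroup.map_le_iff_le_comap]
      exact inf_eq_left.1 e) (by
      intro W hVW hWP
      have h1 : V' < W.map f := by
        refine lt_of_le_of_ne ?_ ?_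
        · intro v hv
          obtain ⟨x, hx, rfl⟩ := hVmap v hv
          exact Subgroup.mem_map_of_mem f (hVW.le hx)
        · intro e
          apply hVW.not_ge
          refine le_inf hWP ?_
          rw [← Subgroup.map_le_iff_le_comap, ← e]
      have h2 := hV2 _ h1 (Subgroup.map_mono hWP)
      apply le_antisymm hWP
      intro x hx
      have hx' : f x ∈ W.map f := by rw [h2]; exact Subgroup.mem_map_of_mem f hx
      obtain ⟨w, hw, e⟩ := hx'
      have h3 : w⁻¹ * x ∈ (P : Subgroup G) ⊓ V'.comap f := by
        refine ⟨Subgroup.mul_mem _ (Subgroup.inv_mem _ (hWP hw)) hx, ?_⟩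
        show f (w⁻¹ * x) ∈ V'
        rw [map_mul, map_inv, e, inv_mul_cancel]
        exact V'.one_mem
      have h4 := W.mul_mem hw (hVW.le h3)
      simpa using h4)
  refine ⟨T.map f, ?_, SS_map hT2 (f.subgroupMap T) (f.subgroupMap_surjective T),
    fun i => (hT3 i).map (f.subgroupMap T) (f.subgroupMap_surjective T)⟩
  intro x
  obtain ⟨x, rfl⟩ := hf x
  obtain ⟨v, hv, t, ht, e⟩ := hT1 x
  exact ⟨f v, hv.2, f t, Subgroup.mem_map_of_mem f ht, by rw [e, map_mul]⟩

/-- the step lemma for solubility -/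
theorem step (hNo : ∀ k, ∀ M : Subgroup G, M.Normal → PN (σ k) (Nat.card M) → M = ⊥)
    {p q : ℕ} (hpq : p ≠ q) (hp : p.Prime) (hq : q.Prime) {T S : Subgroup G}
    (hT : PN {p} T.index) (hS : PN {q} S.index) (hSS : SigmaSoluble σ S) {i : ι} (hqi : q ∉ σ i)
    (N : Subgroup T) [hN : N.Normal] (hNc : PN (σ i) (Nat.card N)) : N = ⊥ := by
  have hcop : Nat.Coprime (T.relIndex ⊤) (S.relIndex ⊤) := by
    rw [Subgroup.relIndex_top_right, Subgroup.relIndex_top_right]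
    refine PN.coprime hT (hS.mono ?_)
    rintro _ rfl
    simpa using hpq.symm
  have hcov := cover_of_coprime (le_top : T ≤ ⊤) (le_top : S ≤ ⊤) hcop
  have hcov' := cover_of_coprime (le_top : S ≤ ⊤) (le_top : T ≤ ⊤) hcop.symm
  have h1 : N ≤ S.subgroupOf T := by
    refine normal_le_hall hNc ?_
    have : (S.subgroupOf T).index = S.index := by
      show S.relIndex T = _
      rw [← Subgroup.relIndex_top_right]
      exact (relIndex_eq_of_cover le_top hcov').symm
    rw [this]
    refine hS.mono ?_
    rintro _ rfl
    exact hqi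
  have h2 : ∀ n : T, n ∈ N → n.1 ∈ S.normalCore := by
    intro n hn x
    obtain ⟨s, hs, t, ht, rfl⟩ := hcov x trivial
    have h3 : (⟨t, ht⟩ * n * (⟨t, ht⟩ : T)⁻¹) ∈ N := hN.conj_mem n hn _
    have h4 : t * n.1 * t⁻¹ ∈ S := h1 h3
    have e : s * t * n.1 * (s * t)⁻¹ = s * (t * n.1 * t⁻¹) * s⁻¹ := by group
    rw [e]
    exact S.mul_mem (S.mul_mem hs h4) (S.inv_mem hs)
  have hE : S.normalCore.Normal := inferInstance
  have hESS : SigmaSoluble σ S.normalCore :=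
    SS_of_injective hSS (Subgroup.inclusion S.normalCore_le) (Subgroup.inclusion_injective _)
  by_cases hEb : (⊤ : Subgroup S.normalCore) = ⊥
  · rw [eq_bot_iff]
    intro n hn
    have h5 : (⟨n.1, h2 n hn⟩ : S.normalCore) ∈ (⊤ : Subgroup S.normalCore) := trivial
    rw [hEb, Subgroup.mem_bot] at h5
    have h6 : n.1 = 1 := congrArg (Subtype.val : S.normalCore → G) h5
    exact Subgroup.mem_bot.2 (Subtype.ext h6)
  exfalso
  obtain ⟨k, M, hM, hM1, -, hMc⟩ := SS_min hESS ⊤ hEb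
  obtain ⟨F, hF, hFc, hFm⟩ := exists_core (σ k) S.normalCore
  have hch : F.Characteristic := by
    rw [Subgroup.characteristic_iff_map_le]
    intro φ
    exact hFm _ (hF.map φ.toMonoidHom φ.surjective) (hFc.dvd (Subgroup.card_map_dvd F _))
  have hFn : (F.map S.normalCore.subtype).Normal := inferInstance
  have h6 := hNo k _ hFn (hFc.dvd (Subgroup.card_map_dvd F _))
  have h7 := (Subgroup.map_eq_bot_iff_of_injective _ (Subgroup.subtype_injective _)).1 h6
  apply hM1
  rw [eq_bot_iff, ← h7]
  exact hFm M hM hMc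

/-- extraction of a Hall subgroup from a supplement. -/
theorem extract {π : Set ℕ} {T : Subgroup G} (hL : LP π T) (hTi : PN πᶜ T.index)
    (hO : ∀ N : Subgroup T, N.Normal → PN πᶜ (Nat.card N) → N = ⊥) :
    ∃ B : Subgroup G, IsHallSubgroup π B ∧ B ≤ T ∧ T ≤ Subgroup.normalizer (B : Set G) ∧
      ∀ h ∈ B, ∀ t ∈ T, PN πᶜ (orderOf t) → ∃ n : ℤ, t * h * t⁻¹ = h ^ n := by
  obtain ⟨A, B, hA, hB, hAB, h1, h2, h3, h4⟩ := hL
  have hAb := hO A hA h1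
  subst hAb
  rw [Subgroup.relIndex_bot_left] at h2
  refine ⟨B.map T.subtype, ⟨h2.dvd (Subgroup.card_map_dvd B _), ?_⟩, Subgroup.map_subtype_le B,
    ?_, ?_⟩
  · rw [Subgroup.index_map_subtype]; exact h3.mul hTi
  · intro t ht
    apply mem_norm_of_conj
    rintro _ ⟨b, hb, rfl⟩
    exact ⟨⟨t, ht⟩ * b * (⟨t, ht⟩ : T)⁻¹, hB.conj_mem b hb _, rfl⟩
  · rintro _ ⟨b, hb, rfl⟩ t ht hto
    obtain ⟨n, hn⟩ := h4 b ⟨t, ht⟩ (elem_of_card h2 hb) (by rwa [Subgroup.orderOf_mk])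
    refine ⟨n, ?_⟩
    have h5 := mul_inv_eq_one.1 (Subgroup.mem_bot.1 hn)
    have h6 := congrArg Subtype.val h5
    simpa using h6

theorem normal_of_CS {π : Set ℕ} {H : Subgroup G} (hH : IsHallSubgroup π H)
    (hconj : ∀ B, IsHallSubgroup π B → ∃ g : G, B = H.map (MulAut.conj g).toMonoidHom)
    (h : ∀ p, p.Prime → p ∣ Nat.card G → p ∉ π → ∀ (P : Sylow p G) (V : Subgroup G), IsMax V P →
      ∃ T : Subgroup G, Cov V T ∧ ∃ B : Subgroup G, IsHallSubgroup π B ∧ T ≤ Subgroup.normalizer (B : Set G)) :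
    H.Normal := by
  rw [← Subgroup.normalizer_eq_top_iff, ← Subgroup.index_eq_one]
  by_contra hne
  obtain ⟨p, hp, hpd⟩ := Nat.exists_prime_and_dvd hne
  have := Fact.mk hp
  by_cases hpi : p ∈ π
  · exact hH.2 p hp (hpd.trans (Subgroup.index_dvd_of_le Subgroup.le_normalizer)) hpi
  · have P : Sylow p G := default
    refine P.not_dvd_index (hpd.trans (Subgroup.index_dvd_of_le ?_))
    apply CS2
    intro V hV
    obtain ⟨T, hT, B, hB, hTB⟩ := h p hp (hpd.trans (Subgroup.index_dvd_card _)) hpi P V hV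
    obtain ⟨g, rfl⟩ := hconj B hB
    refine ⟨T, hT, g, fun t ht => ?_⟩
    apply mem_norm_of_conj
    intro x hx
    have h1 : g * x * g⁻¹ ∈ H.map (MulAut.conj g).toMonoidHom := by
      rw [mem_conj_map]
      have : g⁻¹ * (g * x * g⁻¹) * g = x := by group
      rw [this]; exact hx
    have h2 := conj_of_mem_norm (hTB ht) h1
    rw [mem_conj_map] at h2
    have e : g⁻¹ * t * g * x * (g⁻¹ * t * g)⁻¹ = g⁻¹ * (t * (g * x * g⁻¹) * t⁻¹) * g := by group
    rw [e]; exact h2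

theorem hyp_ne (hG : Hyp σ G) {p : ℕ} (hp : p.Prime) (hpd : p ∣ Nat.card G) :
    ∃ T : Subgroup G, T ≠ ⊥ ∧ PN {p} T.index ∧ SigmaSoluble σ T := by
  have := Fact.mk hp
  have P : Sylow p G := default
  have hlt : (⊥ : Subgroup G) < P := bot_lt_iff_ne_bot.2 (P.ne_bot_of_dvd_card hpd)
  obtain ⟨V, -, hV⟩ := exists_max hlt
  obtain ⟨T, hT1, hT2, hT3⟩ := hG p hp hpd P V hV.1 hV.2
  refine ⟨T, ?_, cov_index (π := {p}) hp (Set.mem_singleton p) P hV.1.le hT1, hT2⟩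
  rintro rfl
  apply hV.1.not_ge
  intro x hx
  obtain ⟨v, hv, t, ht, e⟩ := hT1 x
  rw [Subgroup.mem_bot.1 ht, mul_one] at e
  rw [e]; exact hv

theorem noncontra (hσ : SigmaPartition σ) (hG : Hyp σ G) (htop : (⊤ : Subgroup G) ≠ ⊥)
    (hNo : ∀ k, ∀ M : Subgroup G, M.Normal → PN (σ k) (Nat.card M) → M = ⊥) : False := by
  have hprim : ∀ k, ¬ PN (σ k) (Nat.card G) := by
    intro k hk
    exact htop (hNo k ⊤ inferInstance (by rwa [Subgroup.card_top]))
  have star : ∀ p, p.Prime → p ∣ Nat.card G →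
      ∃ i, p ∉ σ i ∧ ∀ q, q.Prime → q ∣ Nat.card G → q ≠ p → q ∈ σ i := by
    intro p hp hpd
    obtain ⟨T, hT1, hT2, hT3⟩ := hyp_ne hG hp hpd
    have htT : (⊤ : Subgroup T) ≠ ⊥ := by
      have : Nontrivial T := (Subgroup.nontrivial_iff_ne_bot T).2 hT1
      exact top_ne_bot
    obtain ⟨i, N, hN, hN1, -, hNc⟩ := SS_min hT3 ⊤ htT
    have h1 : ∀ q, q.Prime → q ∣ Nat.card G → q ≠ p → q ∈ σ i := by
      intro q hq hqd hqp
      by_contra hqi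
      obtain ⟨S, hS1, hS2, hS3⟩ := hyp_ne hG hq hqd
      exact hN1 (step hNo hqp.symm hp hq hT2 hS2 hS3 hqi N hNc)
    refine ⟨i, fun hpi => hprim i ?_, h1⟩
    intro q hq hqd
    by_cases hqp : q = p
    · rwa [hqp]
    · exact h1 q hq hqd hqp
  have hcard : Nat.card G ≠ 1 := by
    intro h
    obtain ⟨k, -⟩ := sig_exists hσ Nat.prime_two
    exact hprim k (by rw [h]; exact PN.one)
  obtain ⟨p, hp, hpd⟩ := Nat.exists_prime_and_dvd hcard
  obtain ⟨i, hpi, hi⟩ := star p hp hpd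
  obtain ⟨q, hq, hqd, hqp⟩ : ∃ q, q.Prime ∧ q ∣ Nat.card G ∧ q ≠ p := by
    by_contra hcon
    push Not at hcon
    obtain ⟨k, hk⟩ := sig_exists hσ hp
    exact hprim k (fun q hq hqd => by rw [hcon q hq hqd]; exact hk)
  obtain ⟨j, hqj, hj⟩ := star q hq hqd
  have hqi : q ∈ σ i := hi q hq hqd hqp
  have hpj : p ∈ σ j := hj p hp hpd hqp.symm
  have hij : i ≠ j := by rintro rfl; exact hpi hpj
  have honly : ∀ r, r.Prime → r ∣ Nat.card G → r = p ∨ r = q := by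
    intro r hr hrd
    by_contra hcon
    push Not at hcon
    exact Set.disjoint_left.1 (hσ.2.1 hij) (hi r hr hrd hcon.1) (hj r hr hrd hcon.2)
  have hri : ∀ r, r.Prime → r ∣ Nat.card G → r ∈ σ i → r = q := by
    intro r hr hrd hri
    rcases honly r hr hrd with h | h
    · rw [h] at hri; exact absurd hri hpi
    · exact h
  obtain ⟨S, hS1, hS2, hS3⟩ := hyp_ne hG hq hqd
  have := Fact.mk hq
  have hSyl : ∀ P : Sylow q G, IsHallSubgroup (σ i) (P : Subgroup G) := by
    intro P
    refine ⟨sylow_PN hq hqi P, fun r hr hrd hri' => ?_⟩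
    have := hri r hr (hrd.trans (Subgroup.index_dvd_card _)) hri'
    subst this
    exact P.not_dvd_index hrd
  have Q : Sylow q G := default
  have hQn : (Q : Subgroup G).Normal := by
    refine normal_of_CS (hSyl Q) ?_ ?_
    · intro B hB
      have hBp : IsPGroup q B := by
        refine IsPGroup.of_card (n := (Nat.card B).primeFactorsList.length)
          (Nat.eq_prime_pow_of_unique_prime_dvd Nat.card_pos.ne' ?_)
        intro d hd hdd
        exact hri d hd (hdd.trans (Subgroup.card_subgroup_dvd_card B)) (hB.1 d hd hdd)
      obtain ⟨P, hP⟩ := hBp.exists_le_sylow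
      obtain ⟨g, rfl⟩ := MulAction.exists_smul_eq G Q P
      refine ⟨g, hall_eq_of_le (hall_conj (hSyl Q) g) hB ?_⟩
      intro b hb
      have h1 := hP hb
      rw [Sylow.coe_subgroup_smul, Subgroup.mem_pointwise_smul_iff_inv_smul_mem, ← map_inv,
        MulAut.smul_def, MulAut.conj_apply, inv_inv] at h1
      exact mem_conj_map.2 h1
    · intro r hr hrd hri' P V hV
      have hrp : r = p := by
        rcases honly r hr hrd with h | h
        · exact h
        · exact absurd hqi (h ▸ hri')
      subst hrp
      obtain ⟨T, hT1, hT2, hT3⟩ := hG r hr hrd P V hV.1 hV.2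
      refine ⟨T, hT1, ?_⟩
      obtain ⟨B, hB1, hB2, hB3, -⟩ := extract (hT3 i) (cov_index hr hri' P hV.1.le hT1) (by
        intro N hN hNc
        refine step hNo hqp.symm hr hq (cov_index (π := {r}) hr (Set.mem_singleton r) P hV.1.le hT1) hS2 hS3 hqj N ?_
        intro d hd hdd
        have hdG : d ∣ Nat.card G := (hdd.trans (Subgroup.card_subgroup_dvd_card N)).trans
          (Subgroup.card_subgroup_dvd_card T)
        refine hj d hd hdG ?_
        rintro rfl
        exact hNc d hd hdd hqi)
      exact ⟨B, hB1, hB3⟩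
  exact Q.ne_bot_of_dvd_card hqd (hNo i _ hQn (hSyl Q).1)

theorem LP_trivial {π : Set ℕ} (htop : (⊤ : Subgroup G) = ⊥) : LP π G := by
  have hall : ∀ x : G, x = 1 := fun x => by
    have : x ∈ (⊤ : Subgroup G) := trivial
    rw [htop] at this
    exact Subgroup.mem_bot.1 this
  refine ⟨⊥, ⊤, inferInstance, inferInstance, bot_le, ?_, ?_, ?_, fun h g _ _ => ⟨0, ?_⟩⟩
  · rw [Subgroup.card_bot]; exact PN.one
  · rw [htop, Subgroup.relIndex_self]; exact PN.one
  · rw [Subgroup.index_top]; exact PN.one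
  · exact Subgroup.mem_bot.2 (hall _)

end s1

theorem claim3_aux {ι : Type*} {σ : ι → Set ℕ} (hσ : SigmaPartition σ) (n : ℕ) :
    ∀ (G : Type u) [Group G] [Finite G], Nat.card G = n → Hyp σ G →
      SigmaSoluble σ G ∧ ∀ i, LP (σ i) G := by
  induction n using Nat.strong_induction_on with
  | _ n ih =>
    intro G _ _ hn hG
    have ihq : ∀ (N : Subgroup G) [N.Normal], N ≠ ⊥ →
        SigmaSoluble σ (G ⧸ N) ∧ ∀ i, LP (σ i) (G ⧸ N) := by
      intro N hN hN1
      exact ih _ (hn ▸ card_quot_lt N hN1) (G ⧸ N) rfl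
        (hG.map (QuotientGroup.mk' N) (QuotientGroup.mk'_surjective N))
    by_cases htop : (⊤ : Subgroup G) = ⊥
    · have : Subsingleton G := ⟨fun a b => by
        have ha : a ∈ (⊤ : Subgroup G) := trivial
        have hb : b ∈ (⊤ : Subgroup G) := trivial
        rw [htop, Subgroup.mem_bot] at ha hb
        rw [ha, hb]⟩
      exact ⟨SS_of_subsingleton σ G, fun i => LP_trivial htop⟩
    have hSS : SigmaSoluble σ G := by
      by_cases hex : ∃ k, ∃ M : Subgroup G, M.Normal ∧ PN (σ k) (Nat.card M) ∧ M ≠ ⊥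
      · obtain ⟨k, M, hM, hMc, hM1⟩ := hex
        exact SS_lift (ihq M hM1).1 _ (QuotientGroup.mk'_surjective M) (i := k)
          (by rw [ker_mk'_card]; exact hMc)
      · exfalso
        refine noncontra hσ hG htop ?_
        intro k M hM hMc
        by_contra hM1
        exact hex ⟨k, M, hM, hMc, hM1⟩
    refine ⟨hSS, fun i => ?_⟩
    by_cases hO' : ∃ N : Subgroup G, N.Normal ∧ PN (σ i)ᶜ (Nat.card N) ∧ N ≠ ⊥
    · obtain ⟨N, hN, hNc, hN1⟩ := hO'
      exact LP.lift ((ihq N hN1).2 i) _ (QuotientGroup.mk'_surjective N)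
        (by rw [ker_mk'_card]; exact hNc)
    have hO : ∀ N : Subgroup G, N.Normal → PN (σ i)ᶜ (Nat.card N) → N = ⊥ := by
      intro N h1 h2
      by_contra h3
      exact hO' ⟨N, h1, h2, h3⟩
    obtain ⟨F, hF, hFc, hFm⟩ := exists_core (σ i) G
    have hF1 : F ≠ ⊥ := by
      rintro rfl
      obtain ⟨k, R, hR, hR1, -, hRc⟩ := SS_min hSS ⊤ htop
      by_cases hki : k = i
      · subst hki
        exact hR1 (eq_bot_iff.2 (hFm R hR hRc))
      · exact hR1 (hO R hR (sig_compl hσ (Ne.symm hki) hRc))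
    obtain ⟨H, hH⟩ := hall_exists hσ i hSS
    have hconj : ∀ B, IsHallSubgroup (σ i) B →
        ∃ g : G, B = H.map (MulAut.conj g).toMonoidHom := by
      intro B hB
      have hf := QuotientGroup.mk'_surjective F
      obtain ⟨g, hg⟩ := hall_conjugate hσ (ihq F hF1).1 (ihq F hF1).2
        (hall_map hH (QuotientGroup.mk' F) hf) (hall_map hB (QuotientGroup.mk' F) hf)
      obtain ⟨g, rfl⟩ := hf g
      refine ⟨g, hall_eq_of_le (hall_conj hH g) hB ?_⟩
      intro b hb
      have h1 := Subgroup.mem_map_of_mem (QuotientGroup.mk' F) hb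
      rw [hg, mem_conj_map] at h1
      obtain ⟨x, hx, e⟩ := h1
      rw [← map_inv, ← map_mul, ← map_mul] at e
      have h2 : x⁻¹ * (g⁻¹ * b * g) ∈ F := (QuotientGroup.eq).1 e
      rw [mem_conj_map]
      have h3 := H.mul_mem hx (normal_le_hall hFc hH.2 h2)
      simpa using h3
    have hT : ∀ p, p.Prime → p ∣ Nat.card G → p ∉ σ i → ∀ (P : Sylow p G) (V : Subgroup G),
        IsMax V P → ∃ T : Subgroup G, Cov V T ∧ ∃ B : Subgroup G, IsHallSubgroup (σ i) B ∧
          T ≤ Subgroup.normalizer (B : Set G) ∧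
          ∀ h ∈ B, ∀ t ∈ T, PN (σ i)ᶜ (orderOf t) → ∃ n : ℤ, t * h * t⁻¹ = h ^ n := by
      intro p hp hpd hpi P V hV
      obtain ⟨T, hT1, hT2, hT3⟩ := hG p hp hpd P V hV.1 hV.2
      have hTi : PN (σ i)ᶜ T.index := cov_index hp hpi P hV.1.le hT1
      have hFT : F ≤ T := normal_le_hall hFc hTi
      obtain ⟨B, hB1, hB2, hB3, hB4⟩ := extract (hT3 i) hTi (by
        intro N hN hNc
        rw [eq_bot_iff]
        intro a ha
        have haF : a.1 ∈ F := by
          refine HH hσ hSS i hO F hFc hFm a.1 fun x hx => ?_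
          have hd : Disjoint N (F.subgroupOf T) := by
            rw [disjoint_iff, eq_bot_iff]
            rintro y ⟨hy1, hy2⟩
            refine Subgroup.mem_bot.2 (eq_one_of_mem (π := σ i) ?_ hNc hy2 hy1)
            exact hFc.dvd (Subgroup.card_comap_dvd_of_injective _ _ T.subtype_injective)
          have := Subgroup.commute_of_normal_of_disjoint N (F.subgroupOf T) hN inferInstance hd
            a ⟨x, hFT hx⟩ ha hx
          exact congrArg Subtype.val this.eq
        refine Subgroup.mem_bot.2 (Subtype.ext ?_)
        refine eq_one_of_PN (elem_of_card hFc haF) ?_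
        rw [Subgroup.orderOf_coe]
        exact elem_of_card hNc ha)
      exact ⟨T, hT1, B, hB1, hB3, hB4⟩
    have hHn : H.Normal := by
      refine normal_of_CS hH hconj ?_
      intro p hp hpd hpi P V hV
      obtain ⟨T, hT1, B, hB1, hB3, -⟩ := hT p hp hpd hpi P V hV
      exact ⟨T, hT1, B, hB1, hB3⟩
    have hcyc : ∀ h ∈ H, ∀ g, PN (σ i)ᶜ (orderOf g) → ∃ n : ℤ, g * h * g⁻¹ = h ^ n := by
      intro h hh g hg
      rw [norm_zpowers]
      refine norm_core (π := σ i) _ ?_ g hg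
      intro p hp hpi hpd
      have := Fact.mk hp
      have key : ∀ P : Sylow p G, (P : Subgroup G) ≤
          Subgroup.normalizer (Subgroup.zpowers h : Set G) := by
        intro P
        apply CS1
        intro V hV
        obtain ⟨T, hT1, B, hB1, -, hB4⟩ := hT p hp hpd hpi P V hV
        refine ⟨T, hT1, ?_⟩
        rintro t ⟨ht1, ht2⟩
        rw [← norm_zpowers]
        exact hB4 h (normal_le_hall hH.1 hB1.2 hh) t ht2
          (elem_of_card (sylow_PN (π := (σ i)ᶜ) hp hpi P) ht1)
      have P : Sylow p G := default
      refine ⟨P, P.not_dvd_index, fun x y hy => key (x • P) ?_⟩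
      rw [Sylow.coe_subgroup_smul]
      exact Subgroup.smul_mem_pointwise_smul y (MulAut.conj x) _ hy
    refine ⟨⊥, H, inferInstance, hHn, bot_le, ?_, ?_, hH.2, ?_⟩
    · rw [Subgroup.card_bot]; exact PN.one
    · rw [Subgroup.relIndex_bot_left]; exact hH.1
    · intro h g hh hg
      obtain ⟨n, hn⟩ := hcyc h (mem_of_index hH.2 hh) g hg
      exact ⟨n, Subgroup.mem_bot.2 (mul_inv_eq_one.2 hn)⟩

theorem main {ι : Type*} (σ : ι → Set ℕ)
    (hσ : SigmaPartition σ) (G : Type u) [Group G] [Finite G] :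
    (SigmaSoluble σ G ∧ IsPSigmaT σ G) ↔
      ∀ p : ℕ, p.Prime → p ∣ Nat.card G →
        ∀ (P : Sylow p G) (V : Subgroup G), V < ↑P →
          (∀ W : Subgroup G, V < W → W ≤ ↑P → W = ↑P) →
          ∃ T : Subgroup G, (V : Set G) * (T : Set G) = Set.univ ∧
            SigmaSoluble σ ↥T ∧ IsPSigmaT σ ↥T := by
  constructor
  · rintro ⟨h1, h2⟩ p hp hpd P V hV hV2
    have hinj : Function.Injective (⊤ : Subgroup G).subtype := Subgroup.subtype_injective _
    have h3 := SS_of_injective h1 _ hinj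
    refine ⟨⊤, cov_iff.2 (fun x => ⟨1, V.one_mem, x, trivial, by simp⟩), h3,
      claim2 hσ h3 (fun k => (claim1 hσ h1 h2 k).of_injective _ hinj)⟩
  · intro h
    have hH : Hyp σ G := by
      intro p hp hpd P V hV hV2
      obtain ⟨T, hT1, hT2, hT3⟩ := h p hp hpd P V hV hV2
      exact ⟨T, cov_iff.1 hT1, hT2, claim1 hσ hT2 hT3⟩
    obtain ⟨h1, h2⟩ := claim3_aux hσ _ G rfl hH
    exact ⟨h1, claim2 hσ h1 h2⟩

end PST

/-- **Corollary 1.1.** A finite group `G` is a `σ`-soluble `PσT`-group if and only if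
every maximal subgroup of every Sylow subgroup of `G` has a supplement in `G` that is
a `σ`-soluble `PσT`-group. -/
theorem sigma_soluble_PsigmaT_iff_supplements {ι : Type*} (σ : ι → Set ℕ)
    (hσ : SigmaPartition σ) (G : Type*) [Group G] [Finite G] :
    (SigmaSoluble σ G ∧ IsPSigmaT σ G) ↔
      ∀ p : ℕ, p.Prime → p ∣ Nat.card G →
        ∀ (P : Sylow p G) (V : Subgroup G), V < ↑P →
          (∀ W : Subgroup G, V < W → W ≤ ↑P → W = ↑P) →
          ∃ T : Subgroup G, (V : Set G) * (T : Set G) = Set.univ ∧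
            SigmaSoluble σ ↥T ∧ IsPSigmaT σ ↥T := by
  exact PST.main σ hσ G
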